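/- arXiv:1705.01018 — 2 statements merged into one kernel-verified Lean document; each statement's English description precedes it below -/
import Mathlib

section
/- Let α ∈ ℂ with α ∉ ℤ, N ∈ ℕ, ω_c > 0, μ ∈ [0, ω_c), c_0, …, c_N ∈ ℂ, and let g : [ω_c, ∞) → ℂ be measurable, locally integrable, with g(ω) − Σ_{k=0}^{N} c_k ω^{α−k} = O(ω^{Re α − N − 1}) as ω → +∞. With a_m(μ) := Σ_{n=0}^{m} c_{m−n} (Γ(α+1−m+n)/Γ(α+1−m)) μ^n/n!, define Σ_g(s, μ) := ∫_{ω_c}^{∞} (ω−μ)^s [g(ω) − Σ_{m=0}^{N} a_m(μ)(ω−μ)^{α−m}] dω − Σ_{m=0}^{N} a_m(μ) (ω_c−μ)^{s+α+1−m}/(s+α+1−m). Then: (i) Σ_g(·, μ) is analytic on {s ∈ ℂ : Re s < N − Re α} \ {m − α − 1 : 0 ≤ m ≤ N}; (ii) Σ_g(s, μ) = ∫_{ω_c}^{∞} (ω−μ)^s g(ω) dω whenever Re s < −Re α − 1; (iii) for each m ∈ {0, …, N}, Σ_g(·, μ) has a simple pole at s = m − α − 1 with residue −a_m(μ), i.e.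 lim_{s → m−α−1} (s − (m−α−1)) · Σ_g(s, μ) = −a_m(μ). -/
open MeasureTheory Complex Filter

lemma aux_choose (β : ℂ) (hβ : ∀ n : ℤ, β ≠ (n : ℂ)) (n : ℕ) :
    Ring.choose β n = Complex.Gamma (β + 1) / Complex.Gamma (β + 1 - n) / (n.factorial : ℂ) := by
  have hne : ∀ n : ℕ, Complex.Gamma (β + 1 - n) ≠ 0 := by
    intro n
    apply Complex.Gamma_ne_zero
    intro m h
    apply hβ (n - 1 - m)
    push_cast
    linear_combination h
  have key : ∀ n : ℕ, (descPochhammer ℤ n).smeval β * Complex.Gamma (β + 1 - n)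
      = Complex.Gamma (β + 1) := by
    intro n
    induction n with
    | zero => simp
    | succ n ih =>
      have h1 : Complex.Gamma (β + 1 - n) = (β - n) * Complex.Gamma (β - n) := by
        rw [← Complex.Gamma_add_one]
        · congr 1; ring
        · intro h; apply hβ n; push_cast; linear_combination h
      rw [← ih, h1]
      have : β + 1 - ((n + 1 : ℕ) : ℂ) = β - n := by push_cast; ring
      rw [this]
      simp [descPochhammer_succ_right, Polynomial.smeval_mul, Polynomial.smeval_natCast]
      ring
  have h2 := Ring.descPochhammer_eq_factorial_smul_choose β n
  have hf : (n.factorial : ℂ) ≠ 0 := by exact_mod_cast n.factorial_ne_zero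
  rw [eq_div_iff hf, eq_div_iff (hne n), ← key n, h2, nsmul_eq_mul]
  ring

lemma aux_taylor (β : ℂ) (μ : ℝ) (hμ0 : 0 ≤ μ) (M : ℕ) :
    (fun x : ℝ => ((x + μ : ℝ) : ℂ) ^ β
      - ∑ n ∈ Finset.range M, Ring.choose β n * (μ : ℂ) ^ n * (x : ℂ) ^ (β - n))
      =O[atTop] fun x : ℝ => x ^ (β.re - M) := by
  have h := (Complex.one_add_cpow_hasFPowerSeriesAt_zero (a := β)).isBigO_sub_partialSum_pow M
  have ht : Tendsto (fun x : ℝ => ((μ / x : ℝ) : ℂ)) atTop (nhds 0) := by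
    have : Tendsto (fun x : ℝ => μ / x) atTop (nhds 0) := tendsto_const_nhds.div_atTop tendsto_id
    simpa [Function.comp_def] using (Complex.continuous_ofReal.tendsto 0).comp this
  have h2 := h.comp_tendsto ht
  have h3 := (Asymptotics.isBigO_refl (fun x : ℝ => (x : ℂ) ^ β) atTop).norm_right.mul h2
  have h4 : (fun x : ℝ => ‖(x : ℂ) ^ β‖ * ((fun z : ℂ => ‖z‖ ^ M) ∘ (fun x : ℝ => ((μ / x : ℝ) : ℂ))) x)
      =O[atTop] fun x : ℝ => x ^ (β.re - M) := by
    refine Asymptotics.IsBigO.of_bound (μ ^ M) ?_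
    filter_upwards [eventually_gt_atTop 0] with x hx
    have : 0 ≤ μ / x := by positivity
    simp only [Function.comp]
    rw [norm_mul, norm_norm, Complex.norm_cpow_eq_rpow_re_of_pos hx, Real.rpow_sub hx, Real.rpow_natCast]
    apply le_of_eq
    simp only [Complex.norm_real, norm_pow, Real.norm_eq_abs, abs_of_nonneg this]
    rw [abs_of_nonneg (by positivity), div_pow]
    field_simp
  refine (h3.congr' ?_ ?_).trans h4
  · filter_upwards [eventually_gt_atTop 0] with x hx
    have hx' : (x : ℂ) ≠ 0 := by exact_mod_cast hx.ne'
    simp only [Function.comp, zero_add]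
    rw [mul_sub]
    congr 1
    · have : (x + μ : ℝ) = x * (1 + μ / x) := by field_simp
      rw [this, Complex.ofReal_mul, Complex.mul_cpow_ofReal_nonneg hx.le (by positivity)]
      push_cast; rfl
    · rw [FormalMultilinearSeries.partialSum, Finset.mul_sum]
      refine Finset.sum_congr rfl fun n _ => ?_
      rw [binomialSeries_apply, Complex.cpow_sub _ _ hx', Complex.cpow_natCast]
      simp only [List.ofFn_const, List.prod_replicate, smul_eq_mul, Complex.ofReal_div, div_pow]
      field_simp
  · filter_upwards with x
    simp

lemma aux_shift (H : ℝ → ℂ) (ωc μ : ℝ) :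
    ∫ ω in Set.Ici ωc, H (ω - μ) = ∫ x in Set.Ioi (ωc - μ), H x := by
  have := (measurePreserving_sub_right volume μ).setIntegral_preimage_emb
    (MeasurableEquiv.subRight μ).measurableEmbedding H (Set.Ici (ωc - μ))
  rw [← integral_Ici_eq_integral_Ioi, ← this]
  congr 2
  ext; simp

lemma aux_sum (α : ℂ) (hα : ∀ n : ℤ, α ≠ (n : ℂ)) (N : ℕ) (μ : ℝ) (c a : ℕ → ℂ)
    (ha : ∀ m : ℕ, a m = ∑ n ∈ Finset.range (m + 1),
      c (m - n) * (Complex.Gamma (α + 1 - (m : ℂ) + (n : ℂ)) / Complex.Gamma (α + 1 - (m : ℂ)))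
        * (μ : ℂ) ^ n / (n.factorial : ℂ)) (x : ℝ) :
    ∑ m ∈ Finset.range (N + 1), a m * (x : ℂ) ^ (α - (m : ℂ)) =
     ∑ k ∈ Finset.range (N + 1), c k * ∑ n ∈ Finset.range (N + 1 - k),
        Ring.choose (α - k) n * (μ : ℂ) ^ n * (x : ℂ) ^ (α - k - n) := by
  simp_rw [Finset.mul_sum]
  rw [← Finset.sum_range_diag_flip (N+1) (fun k n => c k * (Ring.choose (α - k) n * (μ : ℂ) ^ n * (x : ℂ) ^ (α - k - n)))]
  refine Finset.sum_congr rfl fun m _ => ?_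
  rw [ha, ← Finset.sum_flip, Finset.sum_mul]
  refine Finset.sum_congr rfl fun k hk => ?_
  have hk : k ≤ m := Nat.lt_succ_iff.mp (Finset.mem_range.mp hk)
  rw [Nat.sub_sub_self hk, aux_choose (α - k) (fun n h => hα (n + k) (by push_cast; linear_combination h))]
  rw [Nat.cast_sub hk]
  have e1 : α + 1 - (m : ℂ) + (m - k) = α - k + 1 := by ring
  have e2 : α - (k : ℂ) + 1 - (m - k) = α + 1 - m := by ring
  have e3 : α - (k : ℂ) - (m - k) = α - m := by ring
  rw [e1, e2, e3]
  ring

lemma aux_R (α : ℂ) (hα : ∀ n : ℤ, α ≠ (n : ℂ)) (N : ℕ) (μ : ℝ)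
    (hμ0 : 0 ≤ μ) (c a : ℕ → ℂ) (g : ℝ → ℂ)
    (hasymp : (fun ω : ℝ => g ω - ∑ k ∈ Finset.range (N + 1), c k * (ω : ℂ) ^ (α - (k : ℂ)))
      =O[Filter.atTop] fun ω : ℝ => ω ^ (α.re - (N : ℝ) - 1))
    (ha : ∀ m : ℕ, a m = ∑ n ∈ Finset.range (m + 1),
      c (m - n) * (Complex.Gamma (α + 1 - (m : ℂ) + (n : ℂ)) / Complex.Gamma (α + 1 - (m : ℂ)))
        * (μ : ℂ) ^ n / (n.factorial : ℂ)) :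
    (fun x : ℝ => g (x + μ) - ∑ m ∈ Finset.range (N + 1), a m * (x : ℂ) ^ (α - (m : ℂ)))
     =O[atTop] fun x : ℝ => x ^ (α.re - (N : ℝ) - 1) := by
  have h1 := hasymp.comp_tendsto (tendsto_atTop_add_const_right atTop μ tendsto_id)
  have h2 : (fun x : ℝ => (x + μ) ^ (α.re - (N : ℝ) - 1)) =O[atTop]
      fun x : ℝ => x ^ (α.re - (N : ℝ) - 1) := by
    have h0 := aux_taylor ((α.re - N - 1 : ℝ) : ℂ) μ hμ0 0
    refine h0.norm_left.congr' ?_ ?_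
    · filter_upwards [eventually_gt_atTop 0] with x hx
      have : 0 < x + μ := by positivity
      rw [Finset.range_zero, Finset.sum_empty, sub_zero,
        Complex.norm_cpow_eq_rpow_re_of_pos this, Complex.ofReal_re]
    · filter_upwards with x
      rw [Complex.ofReal_re, Nat.cast_zero, sub_zero]
  have h3 : ∀ k ∈ Finset.range (N + 1), (fun x : ℝ => c k * (((x + μ : ℝ) : ℂ) ^ (α - (k : ℂ))
      - ∑ n ∈ Finset.range (N + 1 - k),
        Ring.choose (α - k) n * (μ : ℂ) ^ n * (x : ℂ) ^ (α - k - n))) =O[atTop]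
        fun x : ℝ => x ^ (α.re - (N : ℝ) - 1) := by
    intro k hk
    have hk : k ≤ N + 1 := (Finset.mem_range.mp hk).le
    have := (aux_taylor (α - k) μ hμ0 (N + 1 - k)).const_mul_left (c k)
    have e : (α - k).re - ((N + 1 - k : ℕ) : ℝ) = α.re - N - 1 := by
      rw [Nat.cast_sub hk]
      simp
      ring
    rwa [e] at this
  have h4 := (h1.trans h2).add (Asymptotics.IsBigO.fun_sum h3)
  refine h4.congr_left fun x => ?_
  rw [aux_sum α hα N μ c a ha]
  simp [Finset.sum_sub_distrib, mul_sub]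

lemma aux_locint (ωc μ δ : ℝ) (hδ : 0 < δ) (hd : δ = ωc - μ) (α : ℂ) (N : ℕ) (a : ℕ → ℂ) (g : ℝ → ℂ)
    (hloc : LocallyIntegrableOn g (Set.Ici ωc)) :
    LocallyIntegrableOn ((Set.Ici δ).indicator fun x : ℝ =>
      g (x + μ) - ∑ m ∈ Finset.range (N + 1), a m * (x : ℂ) ^ (α - (m : ℂ))) (Set.Ioi 0) := by
  rw [locallyIntegrableOn_iff isOpen_Ioi.isLocallyClosed]
  intro K hK hKc
  rw [integrableOn_indicator_iff measurableSet_Ici]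
  have hc : IsCompact (Set.Ici δ ∩ K) := hKc.inter_left isClosed_Ici
  refine Integrable.sub ?_ ?_
  · have h1 : IntegrableOn g ((fun x => x + μ) '' (Set.Ici δ ∩ K)) := by
      refine hloc.integrableOn_compact_subset ?_ (hc.image (by fun_prop))
      rintro _ ⟨x, hx, rfl⟩
      have : δ ≤ x := hx.1
      simp only [Set.mem_Ici]
      linarith
    exact ((measurePreserving_add_right volume μ).integrableOn_image
      (MeasurableEquiv.addRight μ).measurableEmbedding).mp h1
  · refine ContinuousOn.integrableOn_compact hc ?_
    refine continuousOn_finsetSum _ fun m _ => continuousOn_const.mul fun x hx => ?_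
    have : 0 < x := hδ.trans_le hx.1
    exact (Complex.continuousAt_ofReal_cpow_const _ _ (Or.inr this.ne')).continuousWithinAt

/-- With `a_m(μ)` as in the text, the function
`Σ_g(s,μ) = ∫_{ω_c}^∞ (ω−μ)^s [g(ω) − ∑_{m=0}^N a_m(μ)(ω−μ)^{α−m}] dω
  − ∑_{m=0}^N a_m(μ)(ω_c−μ)^{s+α+1−m}/(s+α+1−m)`
is analytic on `{Re s < N − Re α} \ {m−α−1 : 0 ≤ m ≤ N}`, coincides with
`∫_{ω_c}^∞ (ω−μ)^s g(ω) dω` for `Re s < −Re α − 1`, and has a simple pole at each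
`s = m−α−1` with residue `−a_m(μ)`. -/
theorem stmt12 (α : ℂ) (hα : ∀ n : ℤ, α ≠ (n : ℂ)) (N : ℕ) (ωc μ : ℝ)
    (hωc : 0 < ωc) (hμ0 : 0 ≤ μ) (hμ : μ < ωc) (c : ℕ → ℂ) (g : ℝ → ℂ)
    (hmeas : Measurable g)
    (hloc : LocallyIntegrableOn g (Set.Ici ωc))
    (hasymp : (fun ω : ℝ => g ω - ∑ k ∈ Finset.range (N + 1), c k * (ω : ℂ) ^ (α - (k : ℂ)))
      =O[Filter.atTop] fun ω : ℝ => ω ^ (α.re - (N : ℝ) - 1))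
    (a : ℕ → ℂ)
    (ha : ∀ m : ℕ, a m = ∑ n ∈ Finset.range (m + 1),
      c (m - n) * (Complex.Gamma (α + 1 - (m : ℂ) + (n : ℂ)) / Complex.Gamma (α + 1 - (m : ℂ)))
        * (μ : ℂ) ^ n / (n.factorial : ℂ))
    (G : ℂ → ℂ)
    (hG : ∀ s : ℂ, G s =
      (∫ ω in Set.Ici ωc, ((ω - μ : ℝ) : ℂ) ^ s *
          (g ω - ∑ m ∈ Finset.range (N + 1), a m * ((ω - μ : ℝ) : ℂ) ^ (α - (m : ℂ))))
        - ∑ m ∈ Finset.range (N + 1),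
            a m * ((ωc - μ : ℝ) : ℂ) ^ (s + α + 1 - (m : ℂ)) / (s + α + 1 - (m : ℂ))) :
    AnalyticOnNhd ℂ G
      ({s : ℂ | s.re < (N : ℝ) - α.re} \
        {s : ℂ | ∃ m ∈ Finset.range (N + 1), s = (m : ℂ) - α - 1}) ∧
    (∀ s : ℂ, s.re < -α.re - 1 →
      G s = ∫ ω in Set.Ici ωc, ((ω - μ : ℝ) : ℂ) ^ s * g ω) ∧
    ∀ m : ℕ, m ≤ N →
      Filter.Tendsto (fun s : ℂ => (s - ((m : ℂ) - α - 1)) * G s)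
        (nhdsWithin ((m : ℂ) - α - 1) {((m : ℂ) - α - 1)}ᶜ) (nhds (-(a m))) := by
  obtain ⟨δ, hd⟩ : ∃ δ : ℝ, δ = ωc - μ := ⟨_, rfl⟩
  have hδ : 0 < δ := by rw [hd]; linarith
  have hδC : (δ : ℂ) ≠ 0 := by exact_mod_cast hδ.ne'
  rw [← hd] at hG
  set R : ℝ → ℂ := fun x => g (x + μ) - ∑ m ∈ Finset.range (N + 1), a m * (x : ℂ) ^ (α - (m : ℂ))
    with hR
  set f : ℝ → ℂ := (Set.Ici δ).indicator R with hf
  have hfl : LocallyIntegrableOn f (Set.Ioi 0) := aux_locint ωc μ δ hδ hd α N a g hloc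
  have hftop : f =O[atTop] fun x : ℝ => x ^ (-(N + 1 - α.re)) := by
    refine (aux_R α hα N μ hμ0 c a g hasymp ha).congr' ?_ ?_
    · filter_upwards [eventually_ge_atTop δ] with x hx
      rw [hf, Set.indicator_of_mem (show x ∈ Set.Ici δ from hx)]
    · filter_upwards with x
      congr 1; ring
  have hfbot : ∀ b : ℝ, f =O[nhdsWithin 0 (Set.Ioi 0)] fun x : ℝ => x ^ (-b) := by
    intro b
    refine (Asymptotics.isBigO_zero (E' := ℂ) (fun x : ℝ => x ^ (-b)) _).congr' ?_ EventuallyEq.rfl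
    have : ∀ᶠ x : ℝ in nhdsWithin 0 (Set.Ioi 0), x < δ :=
      mem_nhdsWithin_of_mem_nhds (Iio_mem_nhds hδ)
    filter_upwards [this] with x hx
    rw [hf, Set.indicator_of_notMem (by simpa using hx)]
  have hI : ∀ s : ℂ, ∀ x : ℝ, (x : ℂ) ^ (s + 1 - 1) • f x
      = (Set.Ici δ).indicator (fun x : ℝ => (x : ℂ) ^ s * R x) x := by
    intro s x
    by_cases hx : x ∈ Set.Ici δ
    · rw [hf, Set.indicator_of_mem hx, Set.indicator_of_mem hx, add_sub_cancel_right, smul_eq_mul]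
    · rw [hf, Set.indicator_of_notMem hx, Set.indicator_of_notMem hx, smul_zero]
  have hsub : Set.Ici δ ⊆ Set.Ioi (0 : ℝ) := fun x hx => hδ.trans_le hx
  have hF : ∀ s : ℂ, mellin f (s + 1) = ∫ x in Set.Ioi δ, (x : ℂ) ^ s * R x := by
    intro s
    rw [mellin]
    simp_rw [hI]
    rw [setIntegral_indicator measurableSet_Ici, Set.inter_eq_self_of_subset_right hsub,
      integral_Ici_eq_integral_Ioi]
  have hFint : ∀ s : ℂ, s.re < N - α.re →
      IntegrableOn (fun x : ℝ => (x : ℂ) ^ s * R x) (Set.Ioi δ) := by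
    intro s hs
    have h := mellinConvergent_of_isBigO_rpow (s := s + 1) hfl hftop (by simp; linarith)
      (hfbot (s.re)) (by simp)
    rw [MellinConvergent] at h
    simp_rw [hI] at h
    rw [integrableOn_indicator_iff measurableSet_Ici, Set.inter_eq_self_of_subset_left hsub] at h
    exact h.mono_set Set.Ioi_subset_Ici_self
  have hFd : ∀ s : ℂ, s.re < N - α.re → DifferentiableAt ℂ (fun s => mellin f (s + 1)) s := by
    intro s hs
    have h := mellin_differentiableAt_of_isBigO_rpow (s := s + 1) hfl hftop (by simp; linarith)
      (hfbot (s.re)) (by simp)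
    exact DifferentiableAt.comp (g := mellin f) (f := fun s : ℂ => s + 1) s h (by fun_prop)
  have hG' : ∀ s : ℂ, G s = mellin f (s + 1) - ∑ m ∈ Finset.range (N + 1),
            a m * (δ : ℂ) ^ (s + α + 1 - (m : ℂ)) / (s + α + 1 - (m : ℂ)) := by
    intro s
    rw [hG, hF, hd, ← aux_shift]
    simp [hR]
  have hpd : ∀ (m : ℕ) (s : ℂ), DifferentiableAt ℂ (fun s : ℂ => a m * (δ : ℂ) ^ (s + α + 1 - (m : ℂ))) s := by
    intro m s
    refine DifferentiableAt.const_mul ?_ _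
    exact DifferentiableAt.const_cpow (by fun_prop) (Or.inl hδC)
  refine ⟨?_, ?_, ?_⟩
  · have hfin : {s : ℂ | ∃ m ∈ Finset.range (N + 1), s = (m : ℂ) - α - 1}.Finite := by
      refine ((Finset.range (N + 1)).image fun m : ℕ => (m : ℂ) - α - 1).finite_toSet.subset ?_
      rintro s ⟨m, hm, rfl⟩
      simp only [Finset.coe_image]
      exact ⟨m, hm, rfl⟩
    refine DifferentiableOn.analyticOnNhd ?_
      ((isOpen_lt Complex.continuous_re continuous_const).sdiff hfin.isClosed)
    rintro s ⟨hs, hs'⟩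
    refine DifferentiableAt.differentiableWithinAt ?_
    rw [show G = _ from funext hG']
    refine (hFd s hs).sub (DifferentiableAt.fun_sum fun m hm => ?_)
    refine (hpd m s).div (by fun_prop) ?_
    intro h
    exact hs' ⟨m, hm, by linear_combination h⟩
  · intro s hs
    have hN : (0 : ℝ) ≤ N := Nat.cast_nonneg N
    have h1 := hFint s (by linarith)
    have hre : ∀ m : ℕ, (s + α - m).re < -1 := by
      intro m
      have : (0 : ℝ) ≤ m := Nat.cast_nonneg m
      simp
      linarith
    have h2 : ∀ m ∈ Finset.range (N + 1),
        IntegrableOn (fun x : ℝ => a m * (x : ℂ) ^ (s + α - m)) (Set.Ioi δ) :=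
      fun m _ => (integrableOn_Ioi_cpow_of_lt (hre m) hδ).const_mul _
    have h3 := aux_shift (fun x => (x : ℂ) ^ s * g (x + μ)) ωc μ
    simp only [sub_add_cancel] at h3
    rw [h3, hG', hF, ← hd]
    have h4 : ∀ x ∈ Set.Ioi δ, (x : ℂ) ^ s * g (x + μ) = (x : ℂ) ^ s * R x
        + ∑ m ∈ Finset.range (N + 1), a m * (x : ℂ) ^ (s + α - m) := by
      intro x hx
      have hx0 : (x : ℂ) ≠ 0 := by exact_mod_cast (hδ.trans hx).ne'
      have : ∑ m ∈ Finset.range (N + 1), a m * (x : ℂ) ^ (s + α - m)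
          = (x : ℂ) ^ s * ∑ m ∈ Finset.range (N + 1), a m * (x : ℂ) ^ (α - m) := by
        rw [Finset.mul_sum]
        refine Finset.sum_congr rfl fun m _ => ?_
        rw [add_sub_assoc, Complex.cpow_add _ _ hx0]
        ring
      rw [this, hR]
      ring
    rw [setIntegral_congr_fun measurableSet_Ioi h4, integral_add h1 (integrable_finsetSum _ h2),
      integral_finsetSum _ h2, sub_eq_add_neg, ← Finset.sum_neg_distrib]
    congr 1
    refine Finset.sum_congr rfl fun m _ => ?_
    rw [integral_const_mul, integral_Ioi_cpow_of_lt (hre m) hδ,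
      show s + α - m + 1 = s + α + 1 - m by ring]
    ring
  · intro m hm
    set p : ℂ := (m : ℂ) - α - 1 with hp
    have hpre : p.re < N - α.re := by
      have : (m : ℝ) ≤ N := by exact_mod_cast hm
      simp [hp]
      linarith
    have hsub : Tendsto (fun s : ℂ => s - p) (nhdsWithin p {p}ᶜ) (nhds 0) := by
      have : Tendsto (fun s : ℂ => s - p) (nhds p) (nhds (p - p)) :=
        (continuous_id.sub continuous_const).tendsto p
      rw [sub_self] at this
      exact this.mono_left nhdsWithin_le_nhds
    have t1 : Tendsto (fun s : ℂ => (s - p) * mellin f (s + 1)) (nhdsWithin p {p}ᶜ) (nhds 0) := by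
      simpa using hsub.mul ((hFd p hpre).continuousAt.tendsto.mono_left nhdsWithin_le_nhds)
    have t2 : ∀ j ∈ Finset.range (N + 1), Tendsto (fun s : ℂ => (s - p) *
        (a j * (δ : ℂ) ^ (s + α + 1 - (j : ℂ)) / (s + α + 1 - (j : ℂ)))) (nhdsWithin p {p}ᶜ)
        (nhds (if j = m then a m else 0)) := by
      intro j _
      have hc : Tendsto (fun s : ℂ => a j * (δ : ℂ) ^ (s + α + 1 - (j : ℂ))) (nhdsWithin p {p}ᶜ)
          (nhds (a j * (δ : ℂ) ^ (p + α + 1 - (j : ℂ)))) :=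
        (hpd j p).continuousAt.tendsto.mono_left nhdsWithin_le_nhds
      by_cases hj : j = m
      · subst hj
        rw [if_pos rfl]
        have e : p + α + 1 - (j : ℂ) = 0 := by rw [hp]; ring
        rw [e, Complex.cpow_zero, mul_one] at hc
        refine hc.congr' ?_
        filter_upwards [self_mem_nhdsWithin] with s hs
        have hs' : s - p ≠ 0 := sub_ne_zero.mpr hs
        have e2 : s + α + 1 - (j : ℂ) = s - p := by rw [hp]; ring
        rw [e2, mul_div_cancel₀ _ hs']
      · rw [if_neg hj]
        have e : p + α + 1 - (j : ℂ) ≠ 0 := by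
          rw [hp, show (m : ℂ) - α - 1 + α + 1 - j = m - j by ring, sub_ne_zero]
          exact_mod_cast Ne.symm hj
        have hden : Tendsto (fun s : ℂ => s + α + 1 - (j : ℂ)) (nhdsWithin p {p}ᶜ)
            (nhds (p + α + 1 - (j : ℂ))) :=
          ((by fun_prop : Continuous fun s : ℂ => s + α + 1 - (j : ℂ)).tendsto p).mono_left
            nhdsWithin_le_nhds
        simpa using hsub.mul (hc.div hden e)
    have t3 := t1.sub (tendsto_finsetSum _ t2)
    have hmem : m ∈ Finset.range (N + 1) := Finset.mem_range.mpr (Nat.lt_succ_of_le hm)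
    rw [Finset.sum_ite_eq' , if_pos hmem, zero_sub] at t3
    refine t3.congr fun s => ?_
    rw [hG', mul_sub, Finset.mul_sum]
end

section
/- (Exact bosonic high-temperature expansion.) Let α ∈ ℂ with α ∉ ℤ, N ∈ ℕ, ω_c > 0, 0 < μ < ω_c, β > 0, c_0, …, c_N ∈ ℂ, and let g : [ω_c, ∞) → ℂ be measurable, locally integrable, with g(ω) − Σ_{k=0}^{N} c_k ω^{α−k} = O(ω^{Re α − N − 1}) as ω → +∞. Let θ be a real number with θ ∉ ℤ, θ > −1, N − Re α − 1 < θ < N − Re α. Then, with a_m(μ) and the continued function Σ_g(s, μ) as below, ∫_{ω_c}^{∞} g(ω)/(e^{β(ω−μ)} − 1) dω = Σ_{m=0}^{N} β^{m−α−1} ζ(α+1−m) Σ_{n=0}^{m} Γ(α+1−m+n) c_{m−n} μ^n/n! + β^{−1} Σ_g(−1, μ) + Σ_{l=0}^{⌊θ⌋} ((−1)^l ζ(−l)/l!) · β^l · Σ_g(l, μ) + (1/(2π)) ∫_{−∞}^{∞} Γ(−θ−it) · ζ(−θ−it) · β^{θ+it} · Σ_g(θ+it, μ) dt, all integrals and sums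 converging absolutely. -/
open MeasureTheory Complex Filter

lemma preconn_halfplane_diff (a : ℝ) (T : Set ℂ) (hT : T.Countable) :
    IsPreconnected ({z : ℂ | a < z.re} \ T) := by
  let φ : ℂ → ℂ := fun u => ((a + Real.exp u.re : ℝ) : ℂ) + (u.im : ℂ) * I
  have hre : ∀ u, (φ u).re = a + Real.exp u.re := by intro u; simp only [φ, add_re, ofReal_re, re_ofReal_mul, I_re, mul_zero, add_zero]
  have him : ∀ u, (φ u).im = u.im := by intro u; simp [φ, Complex.exp_ofReal_im]
  have hφ : Continuous φ := by fun_prop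
  have hinj : Function.Injective φ := by
    intro u v h
    apply Complex.ext
    · have := congrArg Complex.re h
      rw [hre, hre] at this
      exact Real.exp_injective (by linarith)
    · have := congrArg Complex.im h
      rwa [him, him] at this
  have himg : {z : ℂ | a < z.re} \ T = φ '' (φ ⁻¹' T)ᶜ := by
    ext z
    constructor
    · rintro ⟨hz, hzT⟩
      have hz' : a < z.re := hz
      have : φ (⟨Real.log (z.re - a), z.im⟩ : ℂ) = z := by
        apply Complex.ext
        · rw [hre]; simp only; rw [Real.exp_log (by linarith)]; ring
        · rw [him]
      refine ⟨_, ?_, this⟩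
      simp only [Set.mem_compl_iff, Set.mem_preimage]
      rwa [this]
    · rintro ⟨u, hu, rfl⟩
      refine ⟨?_, hu⟩
      show a < (φ u).re
      rw [hre]; linarith [Real.exp_pos u.re]
  rw [himg]
  apply IsPreconnected.image _ _ hφ.continuousOn
  exact ((hT.preimage hinj).isConnected_compl_of_one_lt_rank (by simp)).isPreconnected

lemma ident_halfplane (a b : ℝ) (T : Set ℂ) (hT : T.Finite) (hTb : ∀ z ∈ T, z.re ≤ b)
    (F G : ℂ → ℂ)
    (hF : ∀ z : ℂ, a < z.re → z ∉ T → DifferentiableAt ℂ F z)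
    (hG : ∀ z : ℂ, a < z.re → z ∉ T → DifferentiableAt ℂ G z)
    (h : ∀ z : ℂ, b < z.re → F z = G z) :
    ∀ z : ℂ, a < z.re → z ∉ T → F z = G z := by
  have hopen : IsOpen ({z : ℂ | a < z.re} \ T) :=
    (isOpen_lt continuous_const Complex.continuous_re).sdiff hT.isClosed
  have hFa : AnalyticOnNhd ℂ F ({z : ℂ | a < z.re} \ T) :=
    DifferentiableOn.analyticOnNhd
      (fun z hz => (hF z hz.1 hz.2).differentiableWithinAt) hopen
  have hGa : AnalyticOnNhd ℂ G ({z : ℂ | a < z.re} \ T) :=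
    DifferentiableOn.analyticOnNhd
      (fun z hz => (hG z hz.1 hz.2).differentiableWithinAt) hopen
  have hx : (((max a b + 1 : ℝ) : ℂ)) ∈ ({z : ℂ | a < z.re} \ T) := by
    constructor
    · show a < _
      rw [ofReal_re]; linarith [le_max_left a b]
    · intro hmem
      have := hTb _ hmem
      rw [ofReal_re] at this
      linarith [le_max_right a b]
  have hev : F =ᶠ[nhds (((max a b + 1 : ℝ) : ℂ))] G := by
    have : {z : ℂ | b < z.re} ∈ nhds (((max a b + 1 : ℝ) : ℂ)) :=
      (isOpen_lt continuous_const Complex.continuous_re).mem_nhds (by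
        show b < _
        rw [ofReal_re]; linarith [le_max_right a b])
    filter_upwards [this] with z hz using h z hz
  intro z hz hzT
  exact hFa.eqOn_of_preconnected_of_eventuallyEq hGa
    (preconn_halfplane_diff a T hT.countable) hx hev ⟨hz, hzT⟩

noncomputable def fr : ℝ → ℂ := (Set.Ioi (1:ℝ)).indicator (fun x => ((Int.fract x : ℝ) : ℂ))

lemma fr_meas : Measurable fr := by
  unfold fr
  exact (Complex.measurable_ofReal.comp measurable_fract).indicator measurableSet_Ioi

lemma fr_bound (x : ℝ) : ‖fr x‖ ≤ 1 := by
  unfold fr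
  refine (norm_indicator_le_norm_self _ _).trans ?_
  rw [Complex.norm_real, Real.norm_eq_abs, abs_of_nonneg (Int.fract_nonneg x)]
  exact (Int.fract_lt_one x).le

lemma fr_loc : LocallyIntegrableOn fr (Set.Ioi 0) := by
  apply LocallyIntegrable.locallyIntegrableOn
  exact (locallyIntegrable_const (1:ℝ)).mono fr_meas.aestronglyMeasurable
    (Eventually.of_forall fun x => by simpa using fr_bound x)

lemma fr_top : fr =O[atTop] (fun x : ℝ => x ^ (-(0:ℝ))) := by
  apply Asymptotics.IsBigO.of_bound 1
  exact Eventually.of_forall fun x => by simpa using fr_bound x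

lemma fr_bot (b : ℝ) : fr =O[nhdsWithin 0 (Set.Ioi 0)] (fun x : ℝ => x ^ (-b)) := by
  apply Asymptotics.IsBigO.of_bound 1
  filter_upwards [Ioo_mem_nhdsGT (show (0:ℝ) < 1 by norm_num)] with x hx
  have : fr x = 0 := by
    unfold fr
    apply Set.indicator_of_notMem
    simp only [Set.mem_Ioi, not_lt]; exact hx.2.le
  rw [this]; simp

lemma fr_diff (w : ℂ) (hw : 0 < w.re) : DifferentiableAt ℂ (mellin fr) (-w) :=
  mellin_differentiableAt_of_isBigO_rpow (a := 0) (b := (-w).re - 1) fr_loc fr_top (by simpa using hw)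
    (fr_bot _) (by linarith)

lemma fr_conv (w : ℂ) (hw : 0 < w.re) : MellinConvergent fr (-w) :=
  mellinConvergent_of_isBigO_rpow (a := 0) (b := (-w).re - 1) fr_loc fr_top (by simpa using hw)
    (fr_bot _) (by linarith)

lemma zeta_fr_big (w : ℂ) (hw : 1 < w.re) :
    riemannZeta w = w / (w - 1) - w * mellin fr (-w) := by
  have h1 : LSeries 1 w = w * ∫ t in Set.Ioi (1 : ℝ), (∑ k ∈ Finset.Icc 1 ⌊t⌋₊, (1 : ℕ → ℂ) k) * (t:ℂ) ^ (-(w + 1)) := by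
    refine LSeries_eq_mul_integral' 1 zero_le_one hw ?_
    simp only [Pi.one_apply, norm_one, Finset.sum_const, Nat.card_Icc, nsmul_eq_mul, mul_one, Real.rpow_one]
    simpa using Asymptotics.isBigO_refl _ _
  rw [← LSeries_one_eq_riemannZeta hw, h1]
  have hconv := fr_conv w (by linarith)
  have hm : mellin fr (-w) = ∫ t in Set.Ioi (1:ℝ), (t:ℂ) ^ (-w - 1) * ((Int.fract t : ℝ) : ℂ) := by
    unfold mellin fr
    rw [← integral_indicator measurableSet_Ioi, ← integral_indicator measurableSet_Ioi]
    congr 1; ext t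
    by_cases ht : 1 < t
    · rw [Set.indicator_of_mem (by simp; linarith), Set.indicator_of_mem (by simpa using ht), 
       Set.indicator_of_mem (by simpa using ht), smul_eq_mul]
    · rw [Set.indicator_of_notMem (a := t) (s := Set.Ioi 1) (by simpa using ht)]
      apply Set.indicator_apply_eq_zero.mpr
      intro _
      rw [Set.indicator_of_notMem (a := t) (s := Set.Ioi 1) (by simpa using ht)]
      simp
  have hci : IntegrableOn (fun t : ℝ => (t:ℂ) ^ (-w - 1) * ((Int.fract t : ℝ) : ℂ)) (Set.Ioi 1) := by
    have := hconv.mono_set (Set.Ioi_subset_Ioi (zero_le_one' ℝ))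
    refine this.congr_fun (fun t ht => ?_) measurableSet_Ioi
    simp only [smul_eq_mul, fr]
    rw [Set.indicator_of_mem ht]
  have hpi : IntegrableOn (fun t : ℝ => (t:ℂ) ^ (-w)) (Set.Ioi 1) :=
    integrableOn_Ioi_cpow_of_lt (by simp; linarith) one_pos
  have hpv : ∫ t in Set.Ioi (1:ℝ), (t:ℂ) ^ (-w) = 1 / (w - 1) := by
    rw [integral_Ioi_cpow_of_lt (by simp; linarith) one_pos]
    simp
    rw [show -w + 1 = -(w - 1) by ring, neg_div_neg_eq, one_div]
  have : ∫ t in Set.Ioi (1 : ℝ), (∑ k ∈ Finset.Icc 1 ⌊t⌋₊, (1 : ℕ → ℂ) k) * (t:ℂ) ^ (-(w + 1)) =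
      ∫ t in Set.Ioi (1 : ℝ), ((t:ℂ) ^ (-w) - (t:ℂ) ^ (-w - 1) * ((Int.fract t : ℝ) : ℂ)) := by
    apply setIntegral_congr_fun measurableSet_Ioi
    intro t ht
    have ht' : (1:ℝ) < t := ht
    have ht0 : (t:ℂ) ≠ 0 := by exact_mod_cast (by linarith : t ≠ 0)
    simp only [Pi.one_apply, Finset.sum_const, Nat.card_Icc, nsmul_eq_mul, mul_one]
    have e1 : (t:ℂ) ^ (-w) = (t:ℂ) * (t:ℂ) ^ (-w - 1) := by
      rw [cpow_sub _ _ ht0, cpow_one]; field_simp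
    have e2 : ((⌊t⌋₊ + 1 - 1 : ℕ) : ℂ) = (t : ℂ) - ((Int.fract t : ℝ) : ℂ) := by
      rw [Nat.add_sub_cancel, ← ofReal_sub, Int.self_sub_fract]
      rw [← natCast_floor_eq_intCast_floor (by linarith : 0 ≤ t)]
      simp
    rw [e2, e1, neg_add, ← sub_eq_add_neg]; ring
  rw [this, integral_sub hpi hci, hpv, hm]
  ring

lemma zeta_fr (w : ℂ) (hw : 0 < w.re) (hw1 : w ≠ 1) :
    riemannZeta w = w / (w - 1) - w * mellin fr (-w) := by
  refine ident_halfplane 0 1 {1} (Set.finite_singleton _) (by simp) riemannZeta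
    (fun w => w / (w - 1) - w * mellin fr (-w)) ?_ ?_ zeta_fr_big w hw (by simpa using hw1)
  · intro z _ hz; exact differentiableAt_riemannZeta (by simpa using hz)
  · intro z hz hz1
    have : z - 1 ≠ 0 := sub_ne_zero.mpr (by simpa using hz1)
    have hd : DifferentiableAt ℂ (fun z => mellin fr (-z)) z :=
      DifferentiableAt.comp (g := mellin fr) (f := fun z => -z) z (fr_diff z hz) differentiableAt_id.neg
    fun_prop (disch := assumption)

lemma zeta_line_bound (σ : ℝ) (hσ : 0 < σ) (hσ1 : σ ≠ 1) :
    ∃ C : ℝ, 0 ≤ C ∧ ∀ t : ℝ, ‖riemannZeta (σ + t * I)‖ ≤ C * (σ + |t|) := by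
  refine ⟨1 / |σ - 1| + ∫ t in Set.Ioi (0:ℝ), ‖(t:ℂ) ^ (-(σ:ℂ) - 1) • fr t‖, by positivity, ?_⟩
  intro t
  have hw1 : (σ + t * I : ℂ) - 1 ≠ 0 := by
    intro h
    have := congrArg Complex.re h
    simp at this
    exact hσ1 (by linarith)
  rw [zeta_fr _ (by simpa using hσ) (by intro h; exact hw1 (by rw [h]; ring))]
  have hn : ‖(σ + t * I : ℂ)‖ ≤ σ + |t| := by
    refine (norm_add_le _ _).trans ?_
    simp [abs_of_pos hσ]
  have hd : |σ - 1| ≤ ‖(σ + t * I : ℂ) - 1‖ := by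
    have := Complex.abs_re_le_norm ((σ + t * I : ℂ) - 1)
    simpa using this
  have hpos : 0 < |σ - 1| := abs_pos.mpr (sub_ne_zero.mpr hσ1)
  have hm : ‖mellin fr (-(σ + t * I))‖ ≤ ∫ t in Set.Ioi (0:ℝ), ‖(t:ℂ) ^ (-(σ:ℂ) - 1) • fr t‖ := by
    unfold mellin
    refine (norm_integral_le_integral_norm _).trans (le_of_eq ?_)
    apply setIntegral_congr_fun measurableSet_Ioi
    intro x hx
    simp only [norm_smul]
    rw [norm_cpow_eq_rpow_re_of_pos hx, norm_cpow_eq_rpow_re_of_pos hx]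
    simp
  have : (σ + t * I : ℂ) / ((σ + t * I : ℂ) - 1) - (σ + t * I : ℂ) * mellin fr (-(σ + t * I))
      = (1 / ((σ + t * I : ℂ) - 1) - mellin fr (-(σ + t * I))) * (σ + t * I : ℂ) := by ring
  rw [this, norm_mul]
  refine mul_le_mul ?_ hn (norm_nonneg _) (by positivity)
  refine (norm_sub_le _ _).trans (add_le_add ?_ hm)
  rw [norm_div, norm_one]
  exact one_div_le_one_div_of_le hpos hd

lemma sin_lower (z : ℂ) : |z.im| ^ 3 / 12 ≤ ‖Complex.sin z‖ := by
  have h1 : ‖cexp (-z * I)‖ = Real.exp z.im := by rw [Complex.norm_exp]; simp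
  have h2 : ‖cexp (z * I)‖ = Real.exp (-z.im) := by rw [Complex.norm_exp]; simp
  have h3 : |Real.exp z.im - Real.exp (-z.im)| ≤ 2 * ‖Complex.sin z‖ := by
    have := abs_norm_sub_norm_le (cexp (-z * I)) (cexp (z * I))
    rw [h1, h2] at this
    refine this.trans (le_of_eq ?_)
    rw [Complex.sin]
    simp only [norm_div, norm_mul, norm_I, mul_one, Complex.norm_ofNat]
    ring
  have key : ∀ y : ℝ, 0 ≤ y → y ^ 3 / 6 ≤ Real.exp y - Real.exp (-y) := by
    intro y hy
    have h := Real.sum_le_exp_of_nonneg hy 4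
    have h' : Real.exp (-y) ≤ 1 := Real.exp_le_one_iff.mpr (by linarith)
    simp [Finset.sum_range_succ, Nat.factorial] at h
    nlinarith [sq_nonneg y]
  have h4 : |z.im| ^ 3 / 6 ≤ |Real.exp z.im - Real.exp (-z.im)| := by
    rcases le_total 0 z.im with hy | hy
    · rw [abs_of_nonneg hy]
      exact (key _ hy).trans (le_abs_self _)
    · rw [abs_of_nonpos hy]
      have := key (-z.im) (by linarith)
      rw [neg_neg] at this
      rw [abs_sub_comm]
      exact this.trans (le_abs_self _)
  linarith

lemma sin_ne_zero_of_im {z : ℂ} (hz : z.im ≠ 0) : Complex.sin z ≠ 0 := by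
  intro h
  have := sin_lower z
  rw [h, norm_zero] at this
  have : 0 < |z.im| ^ 3 := by positivity
  linarith

lemma cos_ne_zero_of_im {z : ℂ} (hz : z.im ≠ 0) : Complex.cos z ≠ 0 := by
  rw [← Complex.sin_add_pi_div_two]
  apply sin_ne_zero_of_im
  have : (z + (Real.pi:ℂ) / 2).im = z.im := by
    rw [add_im, show ((Real.pi:ℂ) / 2) = ((Real.pi / 2 : ℝ) : ℂ) by push_cast; rfl, ofReal_im, add_zero]
  rwa [this]

lemma gamma_zeta_formula (w : ℂ) (hw : w.im ≠ 0) :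
    Complex.Gamma (1 - w) * riemannZeta (1 - w) =
      Real.pi * (2 * Real.pi : ℂ) ^ (-w) * riemannZeta w / Complex.sin (Real.pi * w / 2) := by
  have him : ((Real.pi : ℂ) * w / 2).im ≠ 0 := by
    have : ((Real.pi : ℂ) * w / 2).im = Real.pi * w.im / 2 := by
      rw [show (Real.pi : ℂ) * w / 2 = ((Real.pi / 2 : ℝ) : ℂ) * w by push_cast; ring, im_ofReal_mul]
      ring
    rw [this]
    have := Real.pi_ne_zero
    positivity
  have hs := sin_ne_zero_of_im him
  have hc := cos_ne_zero_of_im him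
  rw [riemannZeta_one_sub]
  · have hG := Complex.Gamma_mul_Gamma_one_sub w
    have h2 : Complex.sin (Real.pi * w) = 2 * Complex.sin (Real.pi * w / 2) * Complex.cos (Real.pi * w / 2) := by
      rw [← Complex.sin_two_mul]; congr 1; ring
    rw [h2] at hG
    calc _ = (Complex.Gamma w * Complex.Gamma (1 - w)) * (2 * (2 * Real.pi : ℂ) ^ (-w) * Complex.cos (Real.pi * w / 2) * riemannZeta w) := by ring
      _ = _ := by rw [hG]; field_simp
  · intro n h; apply hw; rw [h]; simp
  · intro h; apply hw; rw [h]; simp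

noncomputable def Kf (θ : ℝ) (t : ℝ) : ℂ :=
  Complex.Gamma (-(θ : ℂ) - (t : ℂ) * Complex.I) * riemannZeta (-(θ : ℂ) - (t : ℂ) * Complex.I)

lemma Kf_cont (θ : ℝ) (hθZ : ∀ n : ℤ, θ ≠ (n : ℝ)) : Continuous (Kf θ) := by
  have hne : ∀ (t : ℝ) (n : ℤ), (-(θ : ℂ) - (t : ℂ) * Complex.I) ≠ n := by
    intro t n h
    have := congrArg Complex.re h
    simp at this
    exact hθZ (-n) (by push_cast; linarith)
  rw [continuous_iff_continuousAt]
  intro t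
  have hl : ContinuousAt (fun t : ℝ => (-(θ : ℂ) - (t : ℂ) * Complex.I)) t := by fun_prop
  unfold Kf
  apply ContinuousAt.mul
  · refine ContinuousAt.comp (g := Complex.Gamma) (f := fun t : ℝ => (-(θ : ℂ) - (t : ℂ) * Complex.I)) ?_ hl
    apply (Complex.differentiableAt_Gamma _ ?_).continuousAt
    intro m
    have := hne t (-m)
    push_cast at this; exact this
  · refine ContinuousAt.comp (g := riemannZeta) (f := fun t : ℝ => (-(θ : ℂ) - (t : ℂ) * Complex.I)) ?_ hl
    apply (differentiableAt_riemannZeta ?_).continuousAt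
    have := hne t 1
    push_cast at this; exact this

lemma Kf_bound (θ : ℝ) (hθZ : ∀ n : ℤ, θ ≠ (n : ℝ)) (hθ1 : -1 < θ) :
    ∃ C : ℝ, ∀ t : ℝ, 1 ≤ |t| → ‖Kf θ t‖ ≤ C * ‖((1:ℝ) + t ^ 2)⁻¹‖ := by
  obtain ⟨C, hC0, hC⟩ := zeta_line_bound (1 + θ) (by linarith) (by
    intro h; exact hθZ 0 (by push_cast; linarith))
  refine ⟨Real.pi * (2 * Real.pi) ^ (-(1 + θ)) * C * (1 + θ + 1) * 12 * 2, ?_⟩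
  intro t ht
  have ht0 : t ≠ 0 := by rintro rfl; simp at ht; linarith
  have e : (-(θ : ℂ) - (t : ℂ) * Complex.I) = 1 - (((1 + θ : ℝ) : ℂ) + t * I) := by push_cast; ring
  unfold Kf
  rw [e, gamma_zeta_formula _ (by simpa using ht0)]
  have him : ((Real.pi : ℂ) * (((1 + θ : ℝ) : ℂ) + t * I) / 2).im = Real.pi / 2 * t := by
    rw [show (Real.pi : ℂ) * (((1 + θ : ℝ) : ℂ) + t * I) / 2 = ((Real.pi / 2 : ℝ) : ℂ) * (((1 + θ : ℝ) : ℂ) + t * I) by push_cast; ring, im_ofReal_mul]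
    simp
  have hs := sin_lower ((Real.pi : ℂ) * (((1 + θ : ℝ) : ℂ) + t * I) / 2)
  rw [him] at hs
  have hs' : |t| ^ 3 / 12 ≤ ‖Complex.sin ((Real.pi : ℂ) * (((1 + θ : ℝ) : ℂ) + t * I) / 2)‖ := by
    refine le_trans ?_ hs
    have : |t| ≤ |Real.pi / 2 * t| := by
      rw [abs_mul, abs_of_pos (show 0 < Real.pi / 2 by positivity)]
      nlinarith [Real.pi_gt_three, abs_nonneg t]
    gcongr
  have hp : ‖(2 * Real.pi : ℂ) ^ (-(((1 + θ : ℝ) : ℂ) + t * I))‖ = (2 * Real.pi) ^ (-(1 + θ)) := by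
    rw [show (2 * Real.pi : ℂ) = ((2 * Real.pi : ℝ) : ℂ) by push_cast; rfl,
      norm_cpow_eq_rpow_re_of_pos (by positivity)]
    simp
  rw [norm_div, norm_mul, norm_mul, hp, Complex.norm_real, Real.norm_of_nonneg Real.pi_pos.le]
  have hpos : 0 < |t| ^ 3 / 12 := by positivity
  calc _ ≤ Real.pi * (2 * Real.pi) ^ (-(1 + θ)) * (C * ((1 + θ) + |t|)) / (|t| ^ 3 / 12) := by
        have h0 : 0 ≤ 1 + θ + |t| := by linarith [abs_nonneg t]
        gcongr
        exact hC t
    _ = Real.pi * (2 * Real.pi) ^ (-(1 + θ)) * C * 12 * (((1 + θ) + |t|) / |t| ^ 3) := by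
        field_simp
    _ ≤ Real.pi * (2 * Real.pi) ^ (-(1 + θ)) * C * 12 * ((1 + θ + 1) * 2 * ((1:ℝ) + t ^ 2)⁻¹) := by
        gcongr
        rw [← div_eq_mul_inv, div_le_div_iff₀ (by positivity) (by positivity)]
        rw [← sq_abs t]
        have h1 : (1 + θ) + |t| ≤ (1 + θ + 1) * |t| := by nlinarith
        have h2 : 1 + |t| ^ 2 ≤ 2 * |t| ^ 2 := by nlinarith
        calc _ ≤ ((1 + θ + 1) * |t|) * (2 * |t| ^ 2) := by
              apply mul_le_mul h1 h2 (by positivity)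
              have : 0 ≤ 1 + θ + 1 := by linarith
              positivity
          _ = _ := by ring
    _ = _ := by
        rw [Real.norm_of_nonneg (by positivity)]; ring

lemma Kf_integrable (θ : ℝ) (hθZ : ∀ n : ℤ, θ ≠ (n : ℝ)) (hθ1 : -1 < θ) :
    Integrable (Kf θ) := by
  obtain ⟨C, hC⟩ := Kf_bound θ hθZ hθ1
  refine (Kf_cont θ hθZ).locallyIntegrable.integrable_of_isBigO_atBot_atTop
    (g := fun t : ℝ => ((1:ℝ) + t ^ 2)⁻¹) (g' := fun t : ℝ => ((1:ℝ) + t ^ 2)⁻¹) ?_ ?_ ?_ ?_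
  · apply Asymptotics.IsBigO.of_bound C
    filter_upwards [eventually_le_atBot (-1 : ℝ)] with t ht
    exact hC t (by rw [abs_of_nonpos (by linarith)]; linarith)
  · exact integrable_inv_one_add_sq.integrableAtFilter _
  · apply Asymptotics.IsBigO.of_bound C
    filter_upwards [eventually_ge_atTop (1 : ℝ)] with t ht
    exact hC t (by rw [abs_of_nonneg (by linarith)]; linarith)
  · exact integrable_inv_one_add_sq.integrableAtFilter _

noncomputable def bose (x : ℝ) : ℂ := 1 / ((Real.exp x : ℂ) - 1)
noncomputable def bn (n : ℕ) : ℂ := algebraMap ℚ ℂ (bernoulli n / n.factorial)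
noncomputable def sing (L : ℕ) (x : ℝ) : ℂ :=
  ∑ n ∈ Finset.range (L + 1), bn n * (x : ℂ) ^ ((n : ℂ) - 1)
noncomputable def fth (L : ℕ) (x : ℝ) : ℂ := bose x - sing L x
noncomputable def QD (L : ℕ) (D : ℝ) (x : ℝ) : ℂ := bose x - (Set.Iio D).indicator (sing L) x

lemma bose_den_pos {x : ℝ} (hx : 0 < x) : x ≤ ‖(Real.exp x : ℂ) - 1‖ := by
  rw [← ofReal_one, ← ofReal_sub, Complex.norm_real, Real.norm_eq_abs]
  refine le_trans ?_ (le_abs_self _)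
  linarith [Real.add_one_le_exp x]

lemma bose_den_ne {x : ℝ} (hx : 0 < x) : (Real.exp x : ℂ) - 1 ≠ 0 := by
  rw [← norm_pos_iff]; exact lt_of_lt_of_le hx (bose_den_pos hx)

lemma poly_dvd (L : ℕ) : (Polynomial.X ^ (L + 2) : Polynomial ℂ) ∣
    (∑ n ∈ Finset.range (L + 1), Polynomial.C (bn n) * Polynomial.X ^ n) *
    ((∑ k ∈ Finset.range (L + 2), Polynomial.C (algebraMap ℚ ℂ (1 / k.factorial)) * Polynomial.X ^ k) - 1)
     - Polynomial.X := by
  rw [Polynomial.X_pow_dvd_iff]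
  intro d hd
  have h := congrArg (PowerSeries.coeff d) (bernoulliPowerSeries_mul_exp_sub_one ℂ)
  rw [PowerSeries.coeff_mul] at h
  rw [Polynomial.coeff_sub, Polynomial.coeff_mul]
  have hX : (Polynomial.X : Polynomial ℂ).coeff d = PowerSeries.coeff d (PowerSeries.X : PowerSeries ℂ) := by
    rw [Polynomial.coeff_X, PowerSeries.coeff_X]
    simp only [eq_comm]
  rw [hX, ← h, sub_eq_zero]
  apply Finset.sum_congr rfl
  rintro ⟨i, j⟩ hij
  rw [Finset.HasAntidiagonal.mem_antidiagonal] at hij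
  simp only at hij ⊢
  rcases Nat.eq_zero_or_pos j with hj | hj
  · subst hj
    simp [PowerSeries.coeff_exp, Polynomial.coeff_one]
  · have hi : i < L + 1 := by omega
    have hj2 : j < L + 2 := by omega
    simp only [Polynomial.finset_sum_coeff, Polynomial.coeff_C_mul, Polynomial.coeff_X_pow, Polynomial.coeff_sub]
    simp only [mul_ite, mul_one, mul_zero, Finset.sum_ite_eq, Finset.mem_range, hi, hj2, if_true]
    rw [map_sub, PowerSeries.coeff_exp, PowerSeries.coeff_one, Polynomial.coeff_one]
    congr 1
    · simp [bernoulliPowerSeries, bn]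

lemma bose_expand (L : ℕ) : ∃ C : ℝ, 0 ≤ C ∧ ∀ x : ℝ, 0 < x → x ≤ 1 →
    ‖(∑ n ∈ Finset.range (L + 1), bn n * (x:ℂ) ^ n) * ((Real.exp x : ℂ) - 1) - x‖ ≤ C * x ^ (L + 2) := by
  obtain ⟨q, hq⟩ := poly_dvd L
  obtain ⟨C1, hC1⟩ := (isCompact_Icc (a := (0:ℝ)) (b := 1)).exists_bound_of_continuousOn
    (f := fun x : ℝ => q.eval (x:ℂ)) (by fun_prop)
  obtain ⟨C2, hC2⟩ := (isCompact_Icc (a := (0:ℝ)) (b := 1)).exists_bound_of_continuousOn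
    (f := fun x : ℝ => ∑ n ∈ Finset.range (L + 1), bn n * (x:ℂ) ^ n) (by fun_prop)
  have hC10 : 0 ≤ C1 := (norm_nonneg _).trans (hC1 0 (by simp))
  have hC20 : 0 ≤ C2 := (norm_nonneg _).trans (hC2 0 (by simp))
  refine ⟨C1 + C2 * (((L + 2).succ : ℝ) * (((L+2).factorial * (L + 2 : ℕ) : ℝ))⁻¹), by positivity, ?_⟩
  intro x hx hx1
  have hmem : x ∈ Set.Icc (0:ℝ) 1 := ⟨hx.le, hx1⟩
  have hnx : ‖(x:ℂ)‖ = x := by rw [Complex.norm_real, Real.norm_of_nonneg hx.le]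
  have hb := Complex.exp_bound (x := (x:ℂ)) (by rw [hnx]; exact hx1) (show 0 < L + 2 by omega)
  rw [hnx] at hb
  have hev := congrArg (Polynomial.eval (x:ℂ)) hq
  simp only [Polynomial.eval_sub, Polynomial.eval_mul, Polynomial.eval_finsetSum, Polynomial.eval_C,
    Polynomial.eval_pow, Polynomial.eval_X, Polynomial.eval_one] at hev
  have hE : (∑ k ∈ Finset.range (L + 2), (algebraMap ℚ ℂ (1 / k.factorial)) * (x:ℂ) ^ k) =
      ∑ m ∈ Finset.range (L + 2), (x:ℂ) ^ m / m.factorial := by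
    apply Finset.sum_congr rfl
    intro k _
    simp; ring
  rw [hE] at hev
  have : (∑ n ∈ Finset.range (L + 1), bn n * (x:ℂ) ^ n) * ((Real.exp x : ℂ) - 1) - x =
     (x:ℂ) ^ (L + 2) * q.eval (x:ℂ) + (∑ n ∈ Finset.range (L + 1), bn n * (x:ℂ) ^ n) *
      (cexp x - ∑ m ∈ Finset.range (L + 2), (x:ℂ) ^ m / m.factorial) := by
    rw [← hev, ofReal_exp]; ring
  rw [this]
  refine (norm_add_le _ _).trans ?_
  rw [norm_mul, norm_mul, norm_pow, hnx, add_mul]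
  apply add_le_add
  · rw [mul_comm]
    exact mul_le_mul_of_nonneg_right (hC1 x hmem) (by positivity)
  · rw [mul_assoc]
    refine mul_le_mul (hC2 x hmem) (hb.trans (le_of_eq ?_)) (norm_nonneg _) hC20
    push_cast; ring

lemma fth_bot (L : ℕ) : fth L =O[nhdsWithin 0 (Set.Ioi 0)] (fun x : ℝ => x ^ (-(-(L:ℝ)))) := by
  obtain ⟨C, hC0, hC⟩ := bose_expand L
  apply Asymptotics.IsBigO.of_bound C
  filter_upwards [Ioo_mem_nhdsGT (show (0:ℝ) < 1 by norm_num)] with x hx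
  have hx0 : (x:ℂ) ≠ 0 := by exact_mod_cast hx.1.ne'
  have hd := bose_den_ne hx.1
  have hs : sing L x = (∑ n ∈ Finset.range (L + 1), bn n * (x:ℂ) ^ n) / x := by
    unfold sing
    rw [Finset.sum_div]
    apply Finset.sum_congr rfl
    intro n _
    rw [cpow_sub _ _ hx0, cpow_natCast, cpow_one]; ring
  have : fth L x = - ((∑ n ∈ Finset.range (L + 1), bn n * (x:ℂ) ^ n) * ((Real.exp x : ℂ) - 1) - x) /
      (x * ((Real.exp x : ℂ) - 1)) := by
    rw [fth, hs, bose]; field_simp; ring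
  rw [this, norm_div, norm_neg, norm_mul, neg_neg, Real.rpow_natCast,
    Complex.norm_real, Real.norm_of_nonneg hx.1.le, Real.norm_of_nonneg (pow_nonneg hx.1.le _)]
  have hxp := hx.1
  calc _ ≤ (C * x ^ (L + 2)) / (x * x) := by
        gcongr
        · exact hC x hx.1 hx.2.le
        · exact bose_den_pos hx.1
    _ = _ := by field_simp; ring

lemma bose_top : bose =O[atTop] (fun x : ℝ => Real.exp (-1 * x)) := by
  apply Asymptotics.IsBigO.of_bound 2
  filter_upwards [eventually_ge_atTop (1:ℝ)] with x hx
  have h2 : 2 ≤ Real.exp x := by linarith [Real.add_one_le_exp x]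
  rw [bose, norm_div, norm_one, ← ofReal_one, ← ofReal_sub, Complex.norm_real, Real.norm_of_nonneg (by linarith),
    Real.norm_of_nonneg (Real.exp_pos _).le, neg_one_mul, Real.exp_neg]
  rw [← div_eq_mul_inv, div_le_div_iff₀ (by linarith) (by linarith)]
  linarith

lemma bose_cont : ContinuousOn bose (Set.Ioi 0) := by
  unfold bose
  apply ContinuousOn.div (by fun_prop) (by fun_prop)
  intro x hx; exact bose_den_ne hx

lemma cpow_cont (s : ℂ) : ContinuousOn (fun x : ℝ => (x:ℂ) ^ s) (Set.Ioi 0) := by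
  intro x hx
  exact (continuousAt_ofReal_cpow_const x s (Or.inr (ne_of_gt hx))).continuousWithinAt

lemma sing_cont (L : ℕ) : ContinuousOn (sing L) (Set.Ioi 0) := by
  unfold sing
  apply continuousOn_finsetSum
  intro n _
  exact continuousOn_const.mul (cpow_cont _)

lemma fth_cont (L : ℕ) : ContinuousOn (fth L) (Set.Ioi 0) := bose_cont.sub (sing_cont L)

lemma fth_top (L : ℕ) : fth L =O[atTop] (fun x : ℝ => x ^ (-(1 - (L:ℝ)))) := by
  unfold fth
  apply Asymptotics.IsBigO.sub
  · exact bose_top.trans (isLittleO_exp_neg_mul_rpow_atTop one_pos _).isBigO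
  · unfold sing
    refine Asymptotics.IsBigO.fun_sum ?_
    intro n hn
    apply Asymptotics.IsBigO.of_bound ‖bn n‖
    filter_upwards [eventually_ge_atTop (1:ℝ)] with x hx
    have hx0 : 0 < x := by linarith
    rw [norm_mul, norm_cpow_eq_rpow_re_of_pos hx0, Real.norm_of_nonneg (by positivity)]
    gcongr
    have : (n:ℝ) ≤ L := by exact_mod_cast Nat.lt_succ_iff.mp (Finset.mem_range.mp hn)
    simp; exact_mod_cast this

lemma QD_loc (L : ℕ) (D : ℝ) : LocallyIntegrableOn (QD L D) (Set.Ioi 0) := by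
  unfold QD
  apply LocallyIntegrableOn.sub
  · exact bose_cont.locallyIntegrableOn measurableSet_Ioi
  · have h := (sing_cont L).locallyIntegrableOn (μ := volume) measurableSet_Ioi
    intro x hx
    obtain ⟨s, hs, hi⟩ := h x hx
    exact ⟨s, hs, hi.indicator measurableSet_Iio⟩

lemma QD_top (L : ℕ) (D : ℝ) : QD L D =O[atTop] (fun x : ℝ => Real.exp (-1 * x)) := by
  refine bose_top.congr' ?_ EventuallyEq.rfl
  filter_upwards [eventually_ge_atTop D] with x hx
  rw [QD, Set.indicator_of_notMem (by simpa using hx), sub_zero]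

lemma QD_bot (L : ℕ) {D : ℝ} (hD : 0 < D) :
    QD L D =O[nhdsWithin 0 (Set.Ioi 0)] (fun x : ℝ => x ^ (-(-(L:ℝ)))) := by
  refine (fth_bot L).congr' ?_ EventuallyEq.rfl
  filter_upwards [Ioo_mem_nhdsGT hD] with x hx
  rw [QD, Set.indicator_of_mem (by simpa using hx.2), fth]

lemma QD_conv (L : ℕ) {D : ℝ} (hD : 0 < D) (z : ℂ) (hz : -(L:ℝ) < z.re) :
    MellinConvergent (QD L D) z :=
  mellinConvergent_of_isBigO_rpow_exp one_pos (QD_loc L D) (QD_top L D) (QD_bot L hD) hz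

lemma QD_diff (L : ℕ) {D : ℝ} (hD : 0 < D) (z : ℂ) (hz : -(L:ℝ) < z.re) :
    DifferentiableAt ℂ (mellin (QD L D)) z :=
  mellin_differentiableAt_of_isBigO_rpow_exp one_pos (QD_loc L D) (QD_top L D) (QD_bot L hD) hz

lemma fth_conv (L : ℕ) (z : ℂ) (hz : -(L:ℝ) < z.re) (hz2 : z.re < 1 - L) :
    MellinConvergent (fth L) z :=
  mellinConvergent_of_isBigO_rpow ((fth_cont L).locallyIntegrableOn measurableSet_Ioi)
    (fth_top L) hz2 (fth_bot L) hz

lemma low_int (s : ℂ) {D : ℝ} (hD : 0 < D) (hs : -1 < s.re) :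
    IntegrableOn (fun x : ℝ => (x:ℂ) ^ s) (Set.Ioo 0 D) ∧
    ∫ x in Set.Ioo 0 D, (x:ℂ) ^ s = (D:ℂ) ^ (s + 1) / (s + 1) := by
  have hi := intervalIntegral.intervalIntegrable_cpow' hs (a := 0) (b := D)
  have hne : s + 1 ≠ 0 := by
    intro h
    have := congrArg Complex.re h
    simp at this; linarith
  refine ⟨?_, ?_⟩
  · exact ((intervalIntegrable_iff_integrableOn_Ioc_of_le hD.le).mp hi).mono_set Set.Ioo_subset_Ioc_self
  · rw [← integral_Ioc_eq_integral_Ioo, ← intervalIntegral.integral_of_le hD.le, integral_cpow (Or.inl hs)]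
    rw [ofReal_zero, zero_cpow hne, sub_zero]

lemma high_int (s : ℂ) {D : ℝ} (hD : 0 < D) (hs : s.re < -1) :
    IntegrableOn (fun x : ℝ => (x:ℂ) ^ s) (Set.Ici D) ∧
    ∫ x in Set.Ici D, (x:ℂ) ^ s = -(D:ℂ) ^ (s + 1) / (s + 1) := by
  refine ⟨?_, ?_⟩
  · rw [integrableOn_Ici_iff_integrableOn_Ioi]
    exact integrableOn_Ioi_cpow_of_lt hs hD
  · rw [integral_Ici_eq_integral_Ioi, integral_Ioi_cpow_of_lt hs hD]

lemma mellin_bose (z : ℂ) (hz : 1 < z.re) : mellin bose z = Complex.Gamma z * riemannZeta z := by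
  have h := hasSum_mellin (ι := ℕ) (a := fun _ => 1) (p := fun n => (n:ℝ) + 1) (F := bose) (s := z)
    (fun i => Or.inr (by positivity)) (by linarith) ?_ ?_
  · rw [← h.tsum_eq, zeta_eq_tsum_one_div_nat_add_one_cpow hz, ← tsum_mul_left]
    congr 1; ext n; push_cast; ring
  · intro t ht
    have ht' : (0:ℝ) < t := ht
    have hr : Real.exp (-t) < 1 := by rw [Real.exp_lt_one_iff]; linarith
    have hg := (hasSum_geometric_of_lt_one (Real.exp_pos (-t)).le hr).mul_left (Real.exp (-t))
    have hg2 := hasSum_ofReal (L := .unconditional _) |>.mpr hg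
    convert hg2 using 1
    · ext n
      rw [← Real.exp_nat_mul, ← Real.exp_add]
      rw [one_mul]; congr 2; ring
    · rw [bose, Real.exp_neg]
      have := bose_den_ne ht'
      have h3 : Real.exp t - 1 ≠ 0 := by exact_mod_cast this
      have h1 : Real.exp t ≠ 0 := (Real.exp_pos t).ne'
      push_cast
      have h1' : (cexp (t:ℂ)) ≠ 0 := Complex.exp_ne_zero _
      rw [ofReal_exp] at this
      have h4 : 1 - (cexp (t:ℂ))⁻¹ ≠ 0 := by
        intro h; apply this; field_simp at h; simpa using h
      field_simp
  · have := (Real.summable_one_div_nat_rpow.mpr hz)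
    have := (summable_nat_add_iff 1).mpr this
    simpa using this

lemma ind_low (L : ℕ) {D : ℝ} (hD : 0 < D) (z : ℂ) (hz : 1 < z.re) :
    HasMellin ((Set.Iio D).indicator (sing L)) z
      (∑ n ∈ Finset.range (L + 1), bn n * ((D:ℂ) ^ (z + n - 1) / (z + n - 1))) := by
  have key : ∀ n : ℕ, IntegrableOn (fun x : ℝ => (x:ℂ) ^ (z + n - 2)) (Set.Ioo 0 D) ∧ 
     ∫ x in Set.Ioo 0 D, (x:ℂ) ^ (z + n - 2) = (D:ℂ) ^ (z + n - 1) / (z + n - 1) := by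
    intro n
    have := low_int (z + n - 2) hD (by
      have : (0:ℝ) ≤ n := Nat.cast_nonneg n
      simp; linarith)
    rwa [show z + n - 2 + 1 = z + n - 1 by ring] at this
  have e : Set.EqOn (fun x : ℝ => (x:ℂ) ^ (z - 1) • (Set.Iio D).indicator (sing L) x) 
     ((Set.Ioo 0 D).indicator (fun x => ∑ n ∈ Finset.range (L + 1), bn n * (x:ℂ) ^ (z + n - 2))) (Set.Ioi 0) := by
    intro x hx
    have hx' : 0 < x := hx
    have hx0 : (x:ℂ) ≠ 0 := by exact_mod_cast hx'.ne'
    by_cases hxD : x < D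
    · simp only
      rw [Set.indicator_of_mem (show x ∈ Set.Iio D from hxD), Set.indicator_of_mem (show x ∈ Set.Ioo 0 D from ⟨hx, hxD⟩),
       sing, smul_eq_mul, Finset.mul_sum]
      apply Finset.sum_congr rfl
      intro n _
      rw [show z + n - 2 = (z - 1) + (n - 1) by ring, cpow_add _ _ hx0]; ring
    · simp only
      rw [Set.indicator_of_notMem (show x ∉ Set.Iio D from hxD), Set.indicator_of_notMem (fun h => hxD h.2), smul_zero]
  have hnt : IntegrableOn (fun x : ℝ => ∑ n ∈ Finset.range (L + 1), bn n * (x:ℂ) ^ (z + n - 2)) (Set.Ioo 0 D) :=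
    integrable_finsetSum _ (fun n _ => (key n).1.const_mul _)
  refine ⟨?_, ?_⟩
  · unfold MellinConvergent
    rw [integrableOn_congr_fun e measurableSet_Ioi]
    exact (hnt.integrable_indicator measurableSet_Ioo).integrableOn
  · unfold mellin
    rw [setIntegral_congr_fun measurableSet_Ioi e, setIntegral_indicator measurableSet_Ioo,
     Set.inter_eq_right.mpr (fun x hx => hx.1), integral_finsetSum _ (fun n _ => (key n).1.const_mul _)]
    apply Finset.sum_congr rfl
    intro n _
    rw [integral_const_mul, (key n).2]

lemma ind_high (L : ℕ) {D : ℝ} (hD : 0 < D) (z : ℂ) (hz : z.re < 1 - L) :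
    HasMellin ((Set.Ici D).indicator (sing L)) z
      (-∑ n ∈ Finset.range (L + 1), bn n * ((D:ℂ) ^ (z + n - 1) / (z + n - 1))) := by
  have key : ∀ n ∈ Finset.range (L + 1), IntegrableOn (fun x : ℝ => (x:ℂ) ^ (z + n - 2)) (Set.Ici D) ∧ 
     ∫ x in Set.Ici D, (x:ℂ) ^ (z + n - 2) = - (D:ℂ) ^ (z + n - 1) / (z + n - 1) := by
    intro n hn
    have := high_int (z + n - 2) hD (by
      have : (n:ℝ) ≤ L := by exact_mod_cast Nat.lt_succ_iff.mp (Finset.mem_range.mp hn)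
      simp; linarith)
    rwa [show z + n - 2 + 1 = z + n - 1 by ring] at this
  have e : Set.EqOn (fun x : ℝ => (x:ℂ) ^ (z - 1) • (Set.Ici D).indicator (sing L) x) 
     ((Set.Ici D).indicator (fun x => ∑ n ∈ Finset.range (L + 1), bn n * (x:ℂ) ^ (z + n - 2))) (Set.Ioi 0) := by
    intro x hx
    have hx' : 0 < x := hx
    have hx0 : (x:ℂ) ≠ 0 := by exact_mod_cast hx'.ne'
    by_cases hxD : x ∈ Set.Ici D
    · simp only
      rw [Set.indicator_of_mem hxD, Set.indicator_of_mem hxD,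
       sing, smul_eq_mul, Finset.mul_sum]
      apply Finset.sum_congr rfl
      intro n _
      rw [show z + n - 2 = (z - 1) + (n - 1) by ring, cpow_add _ _ hx0]; ring
    · simp only
      rw [Set.indicator_of_notMem hxD, Set.indicator_of_notMem hxD, smul_zero]
  have hnt : IntegrableOn (fun x : ℝ => ∑ n ∈ Finset.range (L + 1), bn n * (x:ℂ) ^ (z + n - 2)) (Set.Ici D) :=
    integrable_finsetSum _ (fun n hn => (key n hn).1.const_mul _)
  refine ⟨?_, ?_⟩
  · unfold MellinConvergent
    rw [integrableOn_congr_fun e measurableSet_Ioi]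
    exact (hnt.integrable_indicator measurableSet_Ici).integrableOn
  · unfold mellin
    rw [setIntegral_congr_fun measurableSet_Ioi e, setIntegral_indicator measurableSet_Ici,
     Set.inter_eq_right.mpr (show Set.Ici D ⊆ Set.Ioi 0 from fun x hx => lt_of_lt_of_le hD hx), integral_finsetSum _ (fun n hn => (key n hn).1.const_mul _),
     ← Finset.sum_neg_distrib]
    apply Finset.sum_congr rfl
    intro n hn
    rw [integral_const_mul, (key n hn).2]; ring

lemma mellin_QD (L : ℕ) {D : ℝ} (hD : 0 < D) (z : ℂ) (hz : -(L:ℝ) < z.re)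
    (hzn : ∀ n ∈ Finset.range (L + 1), z ≠ 1 - n) :
    mellin (QD L D) z = Complex.Gamma z * riemannZeta z -
      ∑ n ∈ Finset.range (L + 1), bn n * ((D:ℂ) ^ (z + n - 1) / (z + n - 1)) := by
  have hD0 : (D:ℂ) ≠ 0 := by exact_mod_cast hD.ne'
  refine ident_halfplane (-(L:ℝ)) 1 ((fun n : ℕ => (1 - n : ℂ)) '' (Finset.range (L + 1)))
    ((Finset.finite_toSet _).image _) ?_ (mellin (QD L D)) (fun z => Complex.Gamma z * riemannZeta z -
      ∑ n ∈ Finset.range (L + 1), bn n * ((D:ℂ) ^ (z + n - 1) / (z + n - 1))) ?_ ?_ ?_ z hz ?_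
  · rintro _ ⟨n, _, rfl⟩; simp
  · intro z hz _; exact QD_diff L hD z hz
  · intro z hz hzT
    have hne : ∀ n ∈ Finset.range (L + 1), z ≠ 1 - n := fun n hn h => hzT ⟨n, hn, h.symm⟩
    apply DifferentiableAt.sub
    · apply DifferentiableAt.mul
      · apply Complex.differentiableAt_Gamma
        intro m h
        have hm : m + 1 < L + 1 := by
          rw [h] at hz; simp at hz; omega
        apply hne (m + 1) (Finset.mem_range.mpr hm)
        rw [h]; push_cast; ring
      · apply differentiableAt_riemannZeta
        have := hne 0 (by simp)
        simpa using this
    · apply DifferentiableAt.fun_sum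
      intro n hn
      have h0 : z + n - 1 ≠ 0 := by
        intro h; apply hne n hn; linear_combination h
      apply DifferentiableAt.const_mul
      refine DifferentiableAt.fun_div ?_ (by fun_prop) h0
      exact DifferentiableAt.const_cpow (by fun_prop) (Or.inl hD0)
  · intro z hz
    have hc := QD_conv L hD z (by have : (0:ℝ) ≤ L := Nat.cast_nonneg L
                                  linarith)
    have hi := ind_low L hD z hz
    have := (hasMellin_add hc hi.1).2
    rw [hi.2] at this
    have e : (fun t => QD L D t + (Set.Iio D).indicator (sing L) t) = bose := by
      ext t; rw [QD]; ring
    rw [e, mellin_bose z hz] at this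
    rw [this]; ring
  · rintro ⟨n, hn, h⟩; exact hzn n hn h.symm

lemma mellin_fth (L : ℕ) (z : ℂ) (hz : -(L:ℝ) < z.re) (hz2 : z.re < 1 - L) :
    mellin (fth L) z = Complex.Gamma z * riemannZeta z := by
  have h1 := mellin_QD L one_pos z hz (by
    intro n hn h
    have : (n:ℝ) ≤ L := by exact_mod_cast Nat.lt_succ_iff.mp (Finset.mem_range.mp hn)
    rw [h] at hz2; simp only [sub_re, one_re, natCast_re] at hz2; linarith [hz2])
  have h2 := ind_high L one_pos z hz2
  have h3 := (hasMellin_sub (QD_conv L one_pos z hz) h2.1).2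
  rw [h2.2, h1] at h3
  have e : (fun t => QD L 1 t - (Set.Ici 1).indicator (sing L) t) = fth L := by
    ext t; rw [QD, fth]
    by_cases ht : t < 1
    · rw [Set.indicator_of_mem (show t ∈ Set.Iio 1 from ht), Set.indicator_of_notMem (by simpa using ht), sub_zero]
    · rw [Set.indicator_of_notMem (show t ∉ Set.Iio 1 from ht), Set.indicator_of_mem (by simpa using ht), sub_zero]
  rw [e] at h3
  rw [h3]; ring

lemma fth_inv (L : ℕ) (θ : ℝ) (hθZ : ∀ n : ℤ, θ ≠ (n : ℝ)) (hθ1 : -1 < θ)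
   (h1 : (L:ℝ) - 1 < θ) (h2 : θ < L) {x : ℝ} (hx : 0 < x) :
   fth L x = (1 / (2 * (Real.pi : ℂ))) * ∫ t : ℝ, Kf θ t * (x:ℂ) ^ ((θ:ℂ) + t * I) := by
  have hm : ∀ y : ℝ, mellin (fth L) (((-θ:ℝ):ℂ) + y * I) = Kf θ (-y) := by
    intro y
    rw [mellin_fth L _ (by simp; linarith) (by simp; linarith), Kf]
    congr 2 <;> (push_cast; ring)
  have hv : VerticalIntegrable (mellin (fth L)) (-θ) := by
    unfold VerticalIntegrable
    simp_rw [hm]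
    exact (Kf_integrable θ hθZ hθ1).comp_neg
  have h := mellinInv_mellin_eq (-θ) (fth L) hx (fth_conv L _ (by simp; linarith) (by simp; linarith)) hv
    ((fth_cont L).continuousAt (Ioi_mem_nhds hx))
  rw [← h, mellinInv]
  simp_rw [hm]
  rw [← integral_neg_eq_self]
  simp only [smul_eq_mul, neg_neg]
  rw [real_smul]
  push_cast
  congr 1
  congr 1; ext t
  rw [mul_comm]; congr 2; ring

lemma desc_gamma (γ : ℂ) (hγ : ∀ n : ℤ, γ ≠ (n:ℂ)) (n : ℕ) :
    (descPochhammer ℤ n).smeval γ = Complex.Gamma (γ + 1) / Complex.Gamma (γ + 1 - n) := by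
  have hne : ∀ k : ℕ, Complex.Gamma (γ + 1 - k) ≠ 0 := by
    intro k
    apply Complex.Gamma_ne_zero
    intro m hm
    apply hγ (k - 1 - m)
    push_cast
    linear_combination hm
  induction n with
  | zero =>
    have := hne 0
    simp at this
    simp [this]
  | succ n ih =>
    have h0 : γ - n ≠ 0 := by
      intro h; apply hγ n; push_cast; linear_combination h
    have h1 : Complex.Gamma (γ + 1 - n) = (γ - n) * Complex.Gamma (γ - n) := by
      rw [← Complex.Gamma_add_one _ h0]; congr 1; ring
    have h2 : Complex.Gamma (γ - n) ≠ 0 := by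
      have := hne (n+1)
      push_cast at this
      convert this using 2; ring
    have h3 : (descPochhammer ℤ (n+1)).smeval γ = (descPochhammer ℤ n).smeval γ * (γ - n) := by
      simp [descPochhammer_succ_right, Polynomial.smeval_mul, Polynomial.smeval_natCast]
    rw [h3, ih, h1, show γ + 1 - ((n+1:ℕ):ℂ) = γ - n by push_cast; ring]
    field_simp

lemma choose_gamma (γ : ℂ) (hγ : ∀ n : ℤ, γ ≠ (n:ℂ)) (n : ℕ) :
    Ring.choose γ n = Complex.Gamma (γ + 1) / Complex.Gamma (γ + 1 - n) / n.factorial := by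
  rw [← desc_gamma γ hγ n, eq_div_iff_mul_eq (by simp [Nat.factorial_ne_zero]), ← nsmul_eq_mul',
    ← Ring.descPochhammer_eq_factorial_smul_choose]

lemma shift_rpow (μ r : ℝ) (hμ : 0 < μ) :
    (fun y : ℝ => (y + μ) ^ r) =O[atTop] (fun y : ℝ => y ^ r) := by
  apply Asymptotics.IsBigO.of_bound (max 1 ((2:ℝ) ^ r))
  filter_upwards [eventually_ge_atTop μ] with y hy
  have hy0 : 0 < y := by linarith
  rw [Real.norm_of_nonneg (by positivity), Real.norm_of_nonneg (by positivity)]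
  rcases le_total 0 r with h | h
  · calc (y + μ) ^ r ≤ (2 * y) ^ r := by gcongr; linarith
      _ = 2 ^ r * y ^ r := Real.mul_rpow (by norm_num) hy0.le
      _ ≤ _ := by gcongr; exact le_max_right _ _
  · calc (y + μ) ^ r ≤ y ^ r := Real.rpow_le_rpow_of_nonpos hy0 (by linarith) h
      _ = 1 * y ^ r := by ring
      _ ≤ _ := by gcongr; exact le_max_left _ _

lemma reexp (γ : ℂ) (μ : ℝ) (hμ : 0 < μ) (M : ℕ) :
    (fun y : ℝ => ((y + μ : ℝ) : ℂ) ^ γ -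
      ∑ n ∈ Finset.range M, Ring.choose γ n * (μ:ℂ) ^ n * (y:ℂ) ^ (γ - (n:ℂ)))
      =O[atTop] (fun y : ℝ => y ^ (γ.re - M)) := by
  have h1 := (Complex.one_add_cpow_hasFPowerSeriesAt_zero (a := γ)).isBigO_sub_partialSum_pow M
  have ht : Tendsto (fun y : ℝ => ((μ / y : ℝ) : ℂ)) atTop (nhds 0) := by
    rw [← Complex.ofReal_zero]
    exact (Complex.continuous_ofReal.tendsto 0).comp (tendsto_const_nhds.div_atTop tendsto_id)
  have h2 := h1.comp_tendsto ht
  have h3 : (fun y : ℝ => (y:ℂ) ^ γ) =O[atTop] (fun y : ℝ => y ^ γ.re) := by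
    apply Asymptotics.IsBigO.of_bound 1
    filter_upwards [eventually_gt_atTop 0] with y hy
    rw [norm_cpow_eq_rpow_re_of_pos hy, Real.norm_of_nonneg (by positivity), one_mul]
  have h4 := h3.mul h2
  have h5 : (fun y : ℝ => y ^ γ.re * ((fun z : ℂ => ‖z‖ ^ M) ∘ fun y : ℝ => ((μ / y : ℝ) : ℂ)) y)
      =O[atTop] (fun y : ℝ => y ^ (γ.re - M)) := by
    apply Asymptotics.IsBigO.of_bound (μ ^ M)
    filter_upwards [eventually_gt_atTop 0] with y hy
    simp only [Function.comp, norm_mul, norm_pow, norm_norm, Complex.norm_real]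
    rw [Real.norm_of_nonneg (by positivity), Real.norm_of_nonneg (by positivity),
      Real.norm_of_nonneg (by positivity), Real.rpow_sub hy, Real.rpow_natCast, div_pow]
    apply le_of_eq; ring
  refine (h4.trans h5).congr' ?_ EventuallyEq.rfl
  filter_upwards [eventually_gt_atTop 0] with y hy
  simp only [Function.comp, zero_add, FormalMultilinearSeries.partialSum, binomialSeries_apply]
  have hyc : (y:ℂ) ≠ 0 := by exact_mod_cast hy.ne'
  have e1 : ((y + μ : ℝ) : ℂ) ^ γ = (y:ℂ)^γ * (1 + ((μ / y : ℝ):ℂ)) ^ γ := by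
    rw [show (1:ℂ) + ((μ / y : ℝ):ℂ) = ((1 + μ / y : ℝ) : ℂ) by push_cast; ring,
      ← Complex.mul_cpow_ofReal_nonneg hy.le (by positivity), ← Complex.ofReal_mul]
    congr 2
    field_simp
  rw [e1, mul_sub, Finset.mul_sum]
  congr 1
  apply Finset.sum_congr rfl
  intro n _
  rw [Complex.cpow_sub _ _ hyc, Complex.cpow_natCast]
  simp [List.ofFn_const, div_pow]
  field_simp

lemma hR_bigO (α : ℂ) (hα : ∀ n : ℤ, α ≠ (n : ℂ)) (N : ℕ) (μ : ℝ)
    (hμ0 : 0 < μ) (c : ℕ → ℂ) (g : ℝ → ℂ)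
    (hasymp : (fun ω : ℝ => g ω - ∑ k ∈ Finset.range (N + 1), c k * (ω : ℂ) ^ (α - (k : ℂ)))
      =O[Filter.atTop] fun ω : ℝ => ω ^ (α.re - (N : ℝ) - 1))
    (a : ℕ → ℂ)
    (ha : ∀ m : ℕ, a m = ∑ n ∈ Finset.range (m + 1),
      c (m - n) * (Complex.Gamma (α + 1 - (m : ℂ) + (n : ℂ)) / Complex.Gamma (α + 1 - (m : ℂ)))
        * (μ : ℂ) ^ n / (n.factorial : ℂ)) :
    (fun y : ℝ => g (y + μ) - ∑ m ∈ Finset.range (N + 1), a m * (y : ℂ) ^ (α - (m : ℂ)))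
      =O[atTop] fun y : ℝ => y ^ (α.re - (N : ℝ) - 1) := by
  have h1 := (hasymp.comp_tendsto (tendsto_atTop_add_const_right atTop μ tendsto_id)).trans
    (shift_rpow μ _ hμ0)
  have h2 : (fun y : ℝ => ∑ k ∈ Finset.range (N + 1), c k * (((y + μ : ℝ) : ℂ) ^ (α - k) -
      ∑ n ∈ Finset.range (N - k + 1), Ring.choose (α - k) n * (μ:ℂ) ^ n * (y:ℂ) ^ (α - k - (n:ℂ))))
      =O[atTop] fun y : ℝ => y ^ (α.re - (N : ℝ) - 1) := by
    refine Asymptotics.IsBigO.fun_sum ?_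
    intro k hk
    have hk' : k ≤ N := Nat.lt_succ_iff.mp (Finset.mem_range.mp hk)
    have := (reexp (α - k) μ hμ0 (N - k + 1)).const_mul_left (c k)
    have e : (α - (k:ℂ)).re - ((N - k + 1 : ℕ) : ℝ) = α.re - (N : ℝ) - 1 := by
      push_cast [Nat.cast_sub hk']
      simp only [Complex.sub_re, Complex.natCast_re]; ring
    rw [e] at this
    exact this
  refine (h1.add h2).congr' ?_ EventuallyEq.rfl
  filter_upwards with y
  have key : ∑ m ∈ Finset.range (N + 1), a m * (y : ℂ) ^ (α - (m : ℂ)) =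
      ∑ k ∈ Finset.range (N + 1), c k * 
      ∑ n ∈ Finset.range (N - k + 1), Ring.choose (α - k) n * (μ:ℂ) ^ n * (y:ℂ) ^ (α - k - (n:ℂ)) := by
    simp_rw [ha, Finset.sum_mul, Finset.mul_sum]
    rw [Finset.sum_sigma', Finset.sum_sigma']
    refine Finset.sum_bij' (fun p _ => ⟨p.1 - p.2, p.2⟩) (fun p _ => ⟨p.1 + p.2, p.2⟩) ?_ ?_ ?_ ?_ ?_
    · intro p hp; simp at hp ⊢; omega
    · intro p hp; simp at hp ⊢; omega
    · rintro ⟨p, q⟩ hp; simp at hp ⊢; omega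
    · rintro ⟨p, q⟩ hp; simp at hp ⊢
    · rintro ⟨m, n⟩ hp
      simp at hp
      have hnm : n ≤ m := by omega
      dsimp only
      rw [choose_gamma]
      · push_cast [Nat.cast_sub hnm]
        rw [show α - (m - n) + 1 = α + 1 - m + n by ring, show α + 1 - m + n - n = α + 1 - m by ring,
          show α - (m - n) - n = α - m by ring]
        ring
      · intro k hk
        apply hα (k + (m - n : ℕ)); push_cast; linear_combination hk
  rw [key]
  simp only [mul_sub, Finset.sum_sub_distrib, Function.comp, id]
  ring

/-- Fubini step. -/
lemma fubini_step (L : ℕ) (θ : ℝ) (hθZ : ∀ n : ℤ, θ ≠ (n : ℝ)) (hθ1 : -1 < θ)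
    (h1 : (L:ℝ) - 1 < θ) (h2 : θ < L) {β : ℝ} (hβ : 0 < β) (h : ℝ → ℂ)
    (hi : IntegrableOn (fun y : ℝ => (y:ℂ) ^ (θ:ℂ) * h y) (Set.Ioi 0)) :
    Integrable (fun t : ℝ => Kf θ t * (β:ℂ) ^ ((θ:ℂ) + t * I) *
      ∫ y in Set.Ioi (0:ℝ), (y:ℂ) ^ ((θ:ℂ) + t * I) * h y) ∧
    ∫ y in Set.Ioi (0:ℝ), h y * fth L (β * y) = (1 / (2 * (Real.pi : ℂ))) *
      ∫ t : ℝ, Kf θ t * (β:ℂ) ^ ((θ:ℂ) + t * I) *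
      ∫ y in Set.Ioi (0:ℝ), (y:ℂ) ^ ((θ:ℂ) + t * I) * h y := by
  have hβc : (β:ℂ) ≠ 0 := by exact_mod_cast hβ.ne'
  let F : ℝ × ℝ → ℂ := fun p => Complex.exp (((p.2 * Real.log (β * p.1) : ℝ) : ℂ) * I) *
    (((β:ℂ) ^ (θ:ℂ) * ((p.1:ℂ) ^ (θ:ℂ) * h p.1)) * Kf θ p.2)
  have hF : Integrable F ((volume.restrict (Set.Ioi (0:ℝ))).prod volume) := by
    apply Integrable.bdd_mul (c := 1)
    · exact Integrable.mul_prod (f := fun y : ℝ => (β:ℂ) ^ (θ:ℂ) * ((y:ℂ) ^ (θ:ℂ) * h y))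
        (hi.integrable.const_mul _) (Kf_integrable θ hθZ hθ1)
    · apply Measurable.aestronglyMeasurable
      have : Measurable (fun p : ℝ × ℝ => Real.log (β * p.1)) :=
        Real.measurable_log.comp (measurable_const.mul measurable_fst)
      fun_prop
    · filter_upwards with p
      rw [Complex.norm_exp_ofReal_mul_I]
  have key : ∀ y : ℝ, 0 < y → ∀ t : ℝ, F (y, t) =
      Kf θ t * (β:ℂ) ^ ((θ:ℂ) + t * I) * ((y:ℂ) ^ ((θ:ℂ) + t * I) * h y) := by
    intro y hy t
    have hyc : (y:ℂ) ≠ 0 := by exact_mod_cast hy.ne'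
    simp only [F]
    rw [Real.log_mul hβ.ne' hy.ne', Complex.cpow_add _ _ hβc, Complex.cpow_add _ _ hyc,
      Complex.cpow_def_of_ne_zero hβc (t * I), Complex.cpow_def_of_ne_zero hyc (t * I),
      ← Complex.ofReal_log hβ.le, ← Complex.ofReal_log hy.le,
      show ((t * (Real.log β + Real.log y) : ℝ) : ℂ) * I =
        (Real.log β : ℂ) * (t * I) + (Real.log y : ℂ) * (t * I) by push_cast; ring, Complex.exp_add]
    ring
  have hG : ∀ t : ℝ, Kf θ t * (β:ℂ) ^ ((θ:ℂ) + t * I) *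
      ∫ y in Set.Ioi (0:ℝ), (y:ℂ) ^ ((θ:ℂ) + t * I) * h y = ∫ y in Set.Ioi (0:ℝ), F (y, t) := by
    intro t
    rw [← integral_const_mul]
    apply setIntegral_congr_fun measurableSet_Ioi
    intro y hy
    exact (key y hy t).symm
  have hL : ∀ y ∈ Set.Ioi (0:ℝ), h y * fth L (β * y) =
      (1 / (2 * (Real.pi : ℂ))) * ∫ t : ℝ, F (y, t) := by
    intro y hy
    have hy' : 0 < y := hy
    rw [fth_inv L θ hθZ hθ1 h1 h2 (mul_pos hβ hy'), mul_left_comm, ← integral_const_mul]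
    congr 2
    ext t
    rw [key y hy', Complex.ofReal_mul, Complex.mul_cpow_ofReal_nonneg hβ.le hy'.le]
    ring
  refine ⟨?_, ?_⟩
  · simp_rw [hG]
    exact hF.integral_prod_right
  · simp_rw [hG]
    rw [setIntegral_congr_fun measurableSet_Ioi hL, integral_const_mul]
    congr 1
    exact integral_integral_swap hF

lemma QD_scaled (L : ℕ) {β D : ℝ} (hβ : 0 < β) (hD : 0 < D) (γ : ℂ) (hz : -(L:ℝ) < (γ+1).re)
    (hzn : ∀ n ∈ Finset.range (L + 1), γ + 1 ≠ 1 - n) :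
    IntegrableOn (fun y : ℝ => (y:ℂ) ^ γ * QD L D (β * y)) (Set.Ioi 0) ∧
    ∫ y in Set.Ioi (0:ℝ), (y:ℂ) ^ γ * QD L D (β * y) = (β:ℂ) ^ (-(γ+1)) *
      (Complex.Gamma (γ+1) * riemannZeta (γ+1) -
      ∑ n ∈ Finset.range (L + 1), bn n * ((D:ℂ) ^ (γ + n) / (γ + n))) := by
  have h1 := (MellinConvergent.comp_mul_left hβ).mpr (QD_conv L hD (γ+1) hz)
  have h2 := mellin_comp_mul_left (QD L D) (γ+1) hβ
  rw [mellin_QD L hD _ hz hzn] at h2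
  unfold MellinConvergent at h1
  unfold mellin at h2
  simp only [add_sub_cancel_right, smul_eq_mul, show ∀ n : ℕ, γ + 1 + (n:ℂ) - 1 = γ + n from
    fun n => by ring] at h1 h2
  exact ⟨h1, h2⟩

lemma hR_int (α : ℂ) (N : ℕ) {δ : ℝ} (hδ : 0 < δ) (hR : ℝ → ℂ)
    (hloc : LocallyIntegrableOn hR (Set.Ici δ))
    (hO : hR =O[atTop] fun y : ℝ => y ^ (α.re - (N : ℝ) - 1)) (s : ℂ) (hs : s.re < N - α.re) :
    IntegrableOn (fun y : ℝ => (y:ℂ) ^ s * hR y) (Set.Ici δ) := by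
  have hc : ContinuousOn (fun y : ℝ => (y:ℂ) ^ s) (Set.Ici δ) :=
    (cpow_cont s).mono (fun y hy => lt_of_lt_of_le hδ hy)
  have hl : LocallyIntegrableOn (fun y : ℝ => (y:ℂ) ^ s * hR y) (Set.Ici δ) :=
    hloc.continuousOn_mul hc isClosed_Ici.isLocallyClosed
  refine hl.integrableOn_of_isBigO_atTop (g := fun y : ℝ => y ^ (s.re + (α.re - N - 1))) ?_
    (integrableAtFilter_rpow_atTop_iff.mpr (by linarith))
  have h3 : (fun y : ℝ => (y:ℂ) ^ s) =O[atTop] (fun y : ℝ => y ^ s.re) := by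
    apply Asymptotics.IsBigO.of_bound 1
    filter_upwards [eventually_gt_atTop 0] with y hy
    rw [norm_cpow_eq_rpow_re_of_pos hy, Real.norm_of_nonneg (by positivity), one_mul]
  refine (h3.mul hO).congr' EventuallyEq.rfl ?_
  filter_upwards [eventually_gt_atTop 0] with y hy
  rw [Real.rpow_add hy]

lemma P_loc (α : ℂ) (N : ℕ) {δ : ℝ} (hδ : 0 < δ) (a : ℕ → ℂ) :
    LocallyIntegrableOn (fun y : ℝ => ∑ m ∈ Finset.range (N + 1), a m * (y : ℂ) ^ (α - (m : ℂ)))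
      (Set.Ici δ) := by
  apply ContinuousOn.locallyIntegrableOn _ measurableSet_Ici
  apply continuousOn_finsetSum
  intro n _
  exact continuousOn_const.mul ((cpow_cont _).mono (fun y hy => lt_of_lt_of_le hδ hy))

lemma g_bose_int (α : ℂ) (N : ℕ) {δ β : ℝ} (hδ : 0 < δ) (hβ : 0 < β) (g : ℝ → ℂ) (a : ℕ → ℂ)
    (hloc : LocallyIntegrableOn g (Set.Ici δ))
    (hO : (fun y : ℝ => g y - ∑ m ∈ Finset.range (N + 1), a m * (y : ℂ) ^ (α - (m : ℂ)))
      =O[atTop] fun y : ℝ => y ^ (α.re - (N : ℝ) - 1)) :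
    IntegrableOn (fun y : ℝ => g y * bose (β * y)) (Set.Ici δ) := by
  have hgO : g =O[atTop] fun y : ℝ => y ^ α.re := by
    have e1 : (fun y : ℝ => y ^ (α.re - (N : ℝ) - 1)) =O[atTop] fun y : ℝ => y ^ α.re := by
      apply Asymptotics.IsBigO.of_bound 1
      filter_upwards [eventually_ge_atTop 1] with y hy
      rw [Real.norm_of_nonneg (by positivity), Real.norm_of_nonneg (by positivity), one_mul]
      apply Real.rpow_le_rpow_of_exponent_le hy
      have : (0:ℝ) ≤ N := by positivity
      linarith
    have e2 : (fun y : ℝ => ∑ m ∈ Finset.range (N + 1), a m * (y : ℂ) ^ (α - (m : ℂ)))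
        =O[atTop] fun y : ℝ => y ^ α.re := by
      refine Asymptotics.IsBigO.fun_sum ?_
      intro m _
      apply Asymptotics.IsBigO.const_mul_left
      apply Asymptotics.IsBigO.of_bound 1
      filter_upwards [eventually_ge_atTop 1] with y hy
      rw [norm_cpow_eq_rpow_re_of_pos (by linarith), Real.norm_of_nonneg (by positivity), one_mul]
      apply Real.rpow_le_rpow_of_exponent_le hy
      simp
    simpa using (hO.trans e1).add e2
  have hb : (fun y : ℝ => bose (β * y)) =O[atTop] fun y : ℝ => y ^ (-α.re - 2) := by
    have := bose_top.comp_tendsto (tendsto_id.const_mul_atTop hβ)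
    refine Asymptotics.IsBigO.trans (this.congr' EventuallyEq.rfl ?_)
      (isLittleO_exp_neg_mul_rpow_atTop hβ (-α.re - 2)).isBigO
    filter_upwards with y
    simp
  have hl : LocallyIntegrableOn (fun y : ℝ => g y * bose (β * y)) (Set.Ici δ) := by
    refine hloc.mul_continuousOn ?_ isClosed_Ici.isLocallyClosed
    apply bose_cont.comp (by fun_prop)
    intro y hy
    exact mul_pos hβ (lt_of_lt_of_le hδ hy)
  refine hl.integrableOn_of_isBigO_atTop (g := fun y : ℝ => y ^ (-2:ℝ)) ?_
    (integrableAtFilter_rpow_atTop_iff.mpr (by norm_num))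
  refine (hgO.mul hb).congr' EventuallyEq.rfl ?_
  filter_upwards [eventually_gt_atTop 0] with y hy
  rw [← Real.rpow_add hy]; congr 1; ring

lemma h_int (α : ℂ) (N : ℕ) {δ : ℝ} (hδ : 0 < δ) (g : ℝ → ℂ) (a : ℕ → ℂ)
    (hloc : LocallyIntegrableOn g (Set.Ici δ))
    (hO : (fun y : ℝ => g y - ∑ m ∈ Finset.range (N + 1), a m * (y : ℂ) ^ (α - (m : ℂ)))
      =O[atTop] fun y : ℝ => y ^ (α.re - (N : ℝ) - 1)) (s : ℂ) (hs : s.re < N - α.re)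
    (hs1 : N - α.re - 1 < s.re) :
    IntegrableOn (fun y : ℝ => (y:ℂ) ^ s * ((Set.Ici δ).indicator g y -
      ∑ m ∈ Finset.range (N + 1), a m * (y : ℂ) ^ (α - (m : ℂ)))) (Set.Ioi 0) ∧
    ∫ y in Set.Ioi (0:ℝ), (y:ℂ) ^ s * ((Set.Ici δ).indicator g y -
      ∑ m ∈ Finset.range (N + 1), a m * (y : ℂ) ^ (α - (m : ℂ))) =
    (∫ y in Set.Ici δ, (y:ℂ) ^ s * (g y -
      ∑ m ∈ Finset.range (N + 1), a m * (y : ℂ) ^ (α - (m : ℂ)))) -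
      ∑ m ∈ Finset.range (N + 1), a m * (δ:ℂ) ^ (s + α + 1 - m) / (s + α + 1 - m) := by
  have hu : Set.Ioi (0:ℝ) = Set.Ioo 0 δ ∪ Set.Ici δ := (Set.Ioo_union_Ici_eq_Ioi hδ).symm
  have i1 := hR_int α N hδ _ (hloc.sub (P_loc α N hδ a)) hO s hs
  have c1 : Set.EqOn (fun y : ℝ => (y:ℂ) ^ s * (g y -
      ∑ m ∈ Finset.range (N + 1), a m * (y : ℂ) ^ (α - (m : ℂ))))
      (fun y : ℝ => (y:ℂ) ^ s * ((Set.Ici δ).indicator g y -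
      ∑ m ∈ Finset.range (N + 1), a m * (y : ℂ) ^ (α - (m : ℂ)))) (Set.Ici δ) := by
    intro y hy
    simp only [Set.indicator_of_mem hy]
  have c2 : Set.EqOn (fun y : ℝ => - ∑ m ∈ Finset.range (N + 1), a m * (y : ℂ) ^ (s + α - (m : ℂ)))
      (fun y : ℝ => (y:ℂ) ^ s * ((Set.Ici δ).indicator g y -
      ∑ m ∈ Finset.range (N + 1), a m * (y : ℂ) ^ (α - (m : ℂ)))) (Set.Ioo 0 δ) := by
    intro y hy
    have hyc : (y:ℂ) ≠ 0 := by exact_mod_cast hy.1.ne'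
    have hn : y ∉ Set.Ici δ := by simpa using hy.2
    simp only [Set.indicator_of_notMem hn, zero_sub, mul_neg, Finset.mul_sum]
    congr 1
    apply Finset.sum_congr rfl
    intro m _
    rw [show s + α - m = s + (α - m) by ring, Complex.cpow_add _ _ hyc]
    ring
  have hm : ∀ m ∈ Finset.range (N+1), -1 < (s + α - (m:ℂ)).re := by
    intro m hm
    have : (m:ℝ) ≤ N := by exact_mod_cast Nat.lt_succ_iff.mp (Finset.mem_range.mp hm)
    simp; linarith
  have i2' : ∀ m ∈ Finset.range (N+1),
      IntegrableOn (fun y : ℝ => a m * (y : ℂ) ^ (s + α - (m : ℂ))) (Set.Ioo 0 δ) :=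
    fun m h => (low_int _ hδ (hm m h)).1.const_mul _
  have i2 : IntegrableOn (fun y : ℝ => - ∑ m ∈ Finset.range (N + 1), a m * (y : ℂ) ^ (s + α - (m : ℂ)))
      (Set.Ioo 0 δ) := (integrable_finsetSum _ i2').neg
  have j1 := i1.congr_fun c1 measurableSet_Ici
  have j2 := i2.congr_fun c2 measurableSet_Ioo
  refine ⟨by rw [hu]; exact j2.union j1, ?_⟩
  rw [hu, setIntegral_union _ measurableSet_Ici j2 j1, ← setIntegral_congr_fun measurableSet_Ici c1,
    ← setIntegral_congr_fun measurableSet_Ioo c2, integral_neg, integral_finsetSum _ i2',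
    neg_add_eq_sub]
  · congr 1
    apply Finset.sum_congr rfl
    intro m h
    rw [integral_const_mul, (low_int _ hδ (hm m h)).2,
      show s + α - m + 1 = s + α + 1 - m by ring, mul_div_assoc]
  · rw [Set.disjoint_left]
    intro y h1 h2
    exact absurd h1.2 (not_lt.mpr h2)

lemma hR_sing (α : ℂ) (N L : ℕ) {δ β : ℝ} (hδ : 0 < δ) (hβ : 0 < β) (hR : ℝ → ℂ)
    (hloc : LocallyIntegrableOn hR (Set.Ici δ))
    (hO : hR =O[atTop] fun y : ℝ => y ^ (α.re - (N : ℝ) - 1)) (hL : (L:ℝ) - 1 < N - α.re) :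
    IntegrableOn (fun y : ℝ => hR y * sing L (β * y)) (Set.Ici δ) ∧
    ∫ y in Set.Ici δ, hR y * sing L (β * y) =
      ∑ n ∈ Finset.range (L + 1), bn n * (β:ℂ) ^ ((n:ℂ) - 1) *
        ∫ y in Set.Ici δ, (y:ℂ) ^ ((n:ℂ) - 1) * hR y := by
  have hi : ∀ n ∈ Finset.range (L + 1), IntegrableOn (fun y : ℝ => bn n * (β:ℂ) ^ ((n:ℂ) - 1) *
      ((y:ℂ) ^ ((n:ℂ) - 1) * hR y)) (Set.Ici δ) := by
    intro n hn
    have : (n:ℝ) ≤ L := by exact_mod_cast Nat.lt_succ_iff.mp (Finset.mem_range.mp hn)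
    exact (hR_int α N hδ hR hloc hO _ (by simp; linarith)).const_mul _
  have he : Set.EqOn (fun y : ℝ => ∑ n ∈ Finset.range (L + 1), bn n * (β:ℂ) ^ ((n:ℂ) - 1) *
      ((y:ℂ) ^ ((n:ℂ) - 1) * hR y)) (fun y : ℝ => hR y * sing L (β * y)) (Set.Ici δ) := by
    intro y hy
    have hy0 : 0 < y := lt_of_lt_of_le hδ hy
    simp only [sing, Finset.mul_sum]
    apply Finset.sum_congr rfl
    intro n _
    rw [Complex.ofReal_mul, Complex.mul_cpow_ofReal_nonneg hβ.le hy0.le]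
    ring
  refine ⟨IntegrableOn.congr_fun (integrable_finsetSum _ hi) he measurableSet_Ici, ?_⟩
  rw [← setIntegral_congr_fun measurableSet_Ici he, integral_finsetSum _ hi]
  apply Finset.sum_congr rfl
  intro n _
  rw [integral_const_mul]

lemma main_y (α : ℂ) (hα : ∀ n : ℤ, α ≠ (n : ℂ)) (N L : ℕ) {δ β : ℝ} (hδ : 0 < δ) (hβ : 0 < β)
    (g : ℝ → ℂ) (a : ℕ → ℂ)
    (hloc : LocallyIntegrableOn g (Set.Ici δ))
    (hO : (fun y : ℝ => g y - ∑ m ∈ Finset.range (N + 1), a m * (y : ℂ) ^ (α - (m : ℂ)))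
      =O[atTop] fun y : ℝ => y ^ (α.re - (N : ℝ) - 1))
    (G : ℂ → ℂ)
    (hG : ∀ s : ℂ, G s =
      (∫ y in Set.Ici δ, (y : ℂ) ^ s *
          (g y - ∑ m ∈ Finset.range (N + 1), a m * (y : ℂ) ^ (α - (m : ℂ))))
        - ∑ m ∈ Finset.range (N + 1),
            a m * (δ : ℂ) ^ (s + α + 1 - (m : ℂ)) / (s + α + 1 - (m : ℂ)))
    (θ : ℝ) (hθZ : ∀ n : ℤ, θ ≠ (n : ℝ)) (hθ1 : -1 < θ)
    (hθ2 : (N : ℝ) - α.re - 1 < θ) (hθ3 : θ < (N : ℝ) - α.re)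
    (h1 : (L:ℝ) - 1 < θ) (h2 : θ < L) :
    Integrable (fun t : ℝ => Kf θ t * (β:ℂ) ^ ((θ:ℂ) + t * I) * G ((θ:ℂ) + t * I)) ∧
    ∫ y in Set.Ici δ, g y * bose (β * y) =
      (∑ m ∈ Finset.range (N + 1), (β : ℂ) ^ ((m : ℂ) - α - 1) *
            riemannZeta (α + 1 - (m : ℂ)) * (a m * Complex.Gamma (α + 1 - m)))
      + ∑ n ∈ Finset.range (L + 1), bn n * (β:ℂ) ^ ((n:ℂ) - 1) * G ((n:ℂ) - 1)
      + (1 / (2 * (Real.pi : ℂ))) *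
        ∫ t : ℝ, Kf θ t * (β:ℂ) ^ ((θ:ℂ) + t * I) * G ((θ:ℂ) + t * I) := by
  have hβc : (β:ℂ) ≠ 0 := by exact_mod_cast hβ.ne'
  set P : ℝ → ℂ := fun y => ∑ m ∈ Finset.range (N + 1), a m * (y : ℂ) ^ (α - (m : ℂ)) with hP
  set h : ℝ → ℂ := fun y => (Set.Ici δ).indicator g y - P y with hh
  have hGh : ∀ t : ℝ, G ((θ:ℂ) + t * I) = ∫ y in Set.Ioi (0:ℝ), (y:ℂ) ^ ((θ:ℂ) + t * I) * h y := by
    intro t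
    rw [hG]
    exact (h_int α N hδ g a hloc hO _ (by simp; linarith) (by simp; linarith)).2.symm
  have hfub := fubini_step L θ hθZ hθ1 h1 h2 hβ h
    (h_int α N hδ g a hloc hO (θ:ℂ) (by simp; linarith) (by simp; linarith)).1
  simp_rw [← hGh] at hfub
  refine ⟨hfub.1, ?_⟩
  rw [← hfub.2]
  have hgb := g_bose_int α N hδ hβ g a hloc hO
  have hs := hR_sing α N L hδ hβ _ (hloc.sub (P_loc α N hδ a)) hO (by linarith)
  have hD : 0 < β * δ := mul_pos hβ hδ
  have hq : ∀ m ∈ Finset.range (N + 1), _ := fun m hm => 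
    QD_scaled L hβ hD (α - (m:ℂ)) (by
      have : (m:ℝ) ≤ N := by exact_mod_cast Nat.lt_succ_iff.mp (Finset.mem_range.mp hm)
      simp; linarith) (by
      intro n _ hn
      apply hα (m - n); push_cast; linear_combination hn)
  have hpt : Set.EqOn (fun y => h y * fth L (β * y)) (fun y =>
      (Set.Ici δ).indicator (fun y => g y * bose (β * y)) y -
      (Set.Ici δ).indicator (fun y => (g y - P y) * sing L (β * y)) y -
      ∑ m ∈ Finset.range (N + 1), a m * ((y:ℂ) ^ (α - (m:ℂ)) * QD L (β * δ) (β * y))) (Set.Ioi 0) := by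
    intro y hy
    have e : ∑ m ∈ Finset.range (N + 1), a m * ((y:ℂ) ^ (α - (m:ℂ)) * QD L (β * δ) (β * y)) =
        P y * QD L (β * δ) (β * y) := by
      rw [hP, Finset.sum_mul]
      apply Finset.sum_congr rfl
      intro m _; ring
    beta_reduce
    rw [e]
    simp only [hh, QD, fth]
    by_cases hyd : δ ≤ y
    · have m1 : y ∈ Set.Ici δ := hyd
      have m2 : β * y ∉ Set.Iio (β * δ) := by
        simp only [Set.mem_Iio, not_lt]; gcongr
      simp only [Set.indicator_of_mem m1, Set.indicator_of_notMem m2]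
      ring
    · have m1 : y ∉ Set.Ici δ := hyd
      have m2 : β * y ∈ Set.Iio (β * δ) := by
        simp only [Set.mem_Iio]; push Not at hyd; gcongr
      simp only [Set.indicator_of_mem m2, Set.indicator_of_notMem m1]
      ring
  have hsub : Set.Ioi (0:ℝ) ∩ Set.Ici δ = Set.Ici δ :=
    Set.inter_eq_right.mpr (fun y hy => lt_of_lt_of_le hδ hy)
  have k1 : IntegrableOn ((Set.Ici δ).indicator (fun y => g y * bose (β * y))) (Set.Ioi 0) :=
    ((integrable_indicator_iff measurableSet_Ici).mpr hgb).integrableOn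
  have k2 : IntegrableOn ((Set.Ici δ).indicator (fun y => (g y - P y) * sing L (β * y))) (Set.Ioi 0) :=
    ((integrable_indicator_iff measurableSet_Ici).mpr hs.1).integrableOn
  have k3' : ∀ m ∈ Finset.range (N + 1), IntegrableOn (fun y : ℝ => 
      a m * ((y:ℂ) ^ (α - (m:ℂ)) * QD L (β * δ) (β * y))) (Set.Ioi 0) :=
    fun m hm => (hq m hm).1.const_mul _
  have k12 : IntegrableOn (fun y => (Set.Ici δ).indicator (fun y => g y * bose (β * y)) y -
      (Set.Ici δ).indicator (fun y => (g y - P y) * sing L (β * y)) y) (Set.Ioi 0) := k1.sub k2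
  rw [setIntegral_congr_fun measurableSet_Ioi hpt,
    integral_sub k12 (integrable_finsetSum _ k3'), integral_sub k1 k2,
    integral_finsetSum _ k3', setIntegral_indicator measurableSet_Ici,
    setIntegral_indicator measurableSet_Ici, hsub]
  have hs2 := hs.2
  simp only [Pi.sub_apply] at hs2
  rw [hs2]
  have e3 : ∑ m ∈ Finset.range (N + 1), ∫ y in Set.Ioi (0:ℝ), 
      a m * ((y:ℂ) ^ (α - (m:ℂ)) * QD L (β * δ) (β * y)) =
      (∑ m ∈ Finset.range (N + 1), (β : ℂ) ^ ((m : ℂ) - α - 1) *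
            riemannZeta (α + 1 - (m : ℂ)) * (a m * Complex.Gamma (α + 1 - m))) -
      ∑ n ∈ Finset.range (L + 1), bn n * (β:ℂ) ^ ((n:ℂ) - 1) * ∑ m ∈ Finset.range (N + 1),
            a m * (δ : ℂ) ^ ((n:ℂ) - 1 + α + 1 - (m : ℂ)) / ((n:ℂ) - 1 + α + 1 - (m : ℂ)) := by
    simp_rw [Finset.mul_sum]
    rw [Finset.sum_comm, ← Finset.sum_sub_distrib]
    apply Finset.sum_congr rfl
    intro m hm
    rw [integral_const_mul, (hq m hm).2, show -(α - (m:ℂ) + 1) = m - α - 1 by ring,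
      show α - (m:ℂ) + 1 = α + 1 - m by ring, mul_sub, mul_sub, Finset.mul_sum, Finset.mul_sum]
    congr 1
    · ring
    apply Finset.sum_congr rfl
    intro n _
    rw [Complex.ofReal_mul, Complex.mul_cpow_ofReal_nonneg hβ.le hδ.le,
      show (n:ℂ) - 1 + α + 1 - m = α - m + n by ring,
      show (n:ℂ) - 1 = (m - α - 1) + (α - m + n) by ring,
      Complex.cpow_add ((m:ℂ) - α - 1) (α - m + n) hβc]
    ring
  rw [e3]
  simp_rw [hG, mul_sub, Finset.sum_sub_distrib]
  ring

lemma bn_zero' : bn 0 = 1 := by simp [bn]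

lemma bn_succ' (l : ℕ) :
    bn (l + 1) = (-1 : ℂ) ^ l * riemannZeta (-(l : ℂ)) / (l.factorial : ℂ) := by
  rw [riemannZeta_neg_nat_eq_bernoulli, bn]
  have h : ((-1:ℂ) ^ l) * (-1) ^ l = 1 := by rw [← mul_pow]; simp
  have h1 : ((l:ℂ) + 1) ≠ 0 := by exact_mod_cast Nat.succ_ne_zero l
  have h2 : (l.factorial : ℂ) ≠ 0 := by exact_mod_cast Nat.factorial_ne_zero l
  rw [Nat.factorial_succ]
  simp only [eq_ratCast]
  push_cast
  rw [show (-1:ℂ) ^ l * ((-1) ^ l * (bernoulli (l + 1) : ℂ) / (l + 1)) =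
    ((-1:ℂ) ^ l * (-1) ^ l) * ((bernoulli (l + 1) : ℂ) / (l + 1)) by ring, h]
  field_simp

lemma shift_set (ωc μ : ℝ) : (fun ω : ℝ => ω - μ) ⁻¹' (Set.Ici (ωc - μ)) = Set.Ici ωc := by
  ext x; simp

lemma shift_integral (ωc μ : ℝ) (F : ℝ → ℂ) :
    ∫ ω in Set.Ici ωc, F (ω - μ) = ∫ y in Set.Ici (ωc - μ), F y := by
  rw [← shift_set ωc μ]
  exact (measurePreserving_sub_right volume μ).setIntegral_preimage_emb
    (MeasurableEquiv.subRight μ).measurableEmbedding F _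

lemma shift_integrable (ωc μ : ℝ) (F : ℝ → ℂ) :
    IntegrableOn (fun ω => F (ω - μ)) (Set.Ici ωc) ↔ IntegrableOn F (Set.Ici (ωc - μ)) := by
  rw [← shift_set ωc μ]
  exact (measurePreserving_sub_right volume μ).integrableOn_comp_preimage
    (MeasurableEquiv.subRight μ).measurableEmbedding

lemma shift_loc (ωc μ : ℝ) (g : ℝ → ℂ) (hloc : LocallyIntegrableOn g (Set.Ici ωc)) :
    LocallyIntegrableOn (fun y => g (y + μ)) (Set.Ici (ωc - μ)) := by
  rw [locallyIntegrableOn_iff isClosed_Ici.isLocallyClosed] at hloc ⊢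
  intro k hk hkc
  have h1 := hloc ((fun y => y + μ) '' k) (by
    rintro _ ⟨y, hy, rfl⟩
    have := hk hy
    simp at this ⊢; linarith) (hkc.image (by fun_prop))
  have h2 := ((measurePreserving_add_right volume μ).integrableOn_comp_preimage
    (MeasurableEquiv.addRight μ).measurableEmbedding).mpr h1
  rwa [Set.preimage_image_eq _ (add_left_injective μ)] at h2

/-- Exact bosonic high-temperature expansion. With `Σ_g(s,μ)` the analytic
continuation of `∫_{ω_c}^∞ (ω−μ)^s g(ω) dω` and `θ` a non-integer real with `θ > −1` and
`N − Re α − 1 < θ < N − Re α`,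
`∫_{ω_c}^∞ g(ω)/(e^{β(ω−μ)}−1) dω
  = ∑_{m=0}^N β^{m−α−1} ζ(α+1−m) ∑_{n=0}^m Γ(α+1−m+n) c_{m−n} μⁿ/n!
    + β^{−1} Σ_g(−1,μ) + ∑_{l=0}^{⌊θ⌋} ((−1)^l ζ(−l)/l!) β^l Σ_g(l,μ)
    + (1/2π) ∫_ℝ Γ(−θ−it) ζ(−θ−it) β^{θ+it} Σ_g(θ+it,μ) dt`,
all integrals converging absolutely. -/
theorem stmt14 (α : ℂ) (hα : ∀ n : ℤ, α ≠ (n : ℂ)) (N : ℕ) (ωc μ β : ℝ)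
    (hωc : 0 < ωc) (hμ0 : 0 < μ) (hμ : μ < ωc) (hβ : 0 < β)
    (c : ℕ → ℂ) (g : ℝ → ℂ)
    (hmeas : Measurable g)
    (hloc : LocallyIntegrableOn g (Set.Ici ωc))
    (hasymp : (fun ω : ℝ => g ω - ∑ k ∈ Finset.range (N + 1), c k * (ω : ℂ) ^ (α - (k : ℂ)))
      =O[Filter.atTop] fun ω : ℝ => ω ^ (α.re - (N : ℝ) - 1))
    (a : ℕ → ℂ)
    (ha : ∀ m : ℕ, a m = ∑ n ∈ Finset.range (m + 1),
      c (m - n) * (Complex.Gamma (α + 1 - (m : ℂ) + (n : ℂ)) / Complex.Gamma (α + 1 - (m : ℂ)))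
        * (μ : ℂ) ^ n / (n.factorial : ℂ))
    (G : ℂ → ℂ)
    (hG : ∀ s : ℂ, G s =
      (∫ ω in Set.Ici ωc, ((ω - μ : ℝ) : ℂ) ^ s *
          (g ω - ∑ m ∈ Finset.range (N + 1), a m * ((ω - μ : ℝ) : ℂ) ^ (α - (m : ℂ))))
        - ∑ m ∈ Finset.range (N + 1),
            a m * ((ωc - μ : ℝ) : ℂ) ^ (s + α + 1 - (m : ℂ)) / (s + α + 1 - (m : ℂ)))
    (θ : ℝ) (hθZ : ∀ n : ℤ, θ ≠ (n : ℝ)) (hθ1 : -1 < θ)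
    (hθ2 : (N : ℝ) - α.re - 1 < θ) (hθ3 : θ < (N : ℝ) - α.re) :
    IntegrableOn (fun ω : ℝ => g ω / ((Real.exp (β * (ω - μ)) : ℂ) - 1)) (Set.Ici ωc) ∧
    Integrable (fun t : ℝ =>
      Complex.Gamma (-(θ : ℂ) - (t : ℂ) * Complex.I) *
        riemannZeta (-(θ : ℂ) - (t : ℂ) * Complex.I) *
        (β : ℂ) ^ ((θ : ℂ) + (t : ℂ) * Complex.I) * G ((θ : ℂ) + (t : ℂ) * Complex.I)) ∧
    (∫ ω in Set.Ici ωc, g ω / ((Real.exp (β * (ω - μ)) : ℂ) - 1))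
      = (∑ m ∈ Finset.range (N + 1), (β : ℂ) ^ ((m : ℂ) - α - 1) *
            riemannZeta (α + 1 - (m : ℂ)) *
            ∑ n ∈ Finset.range (m + 1),
              Complex.Gamma (α + 1 - (m : ℂ) + (n : ℂ)) * c (m - n) * (μ : ℂ) ^ n /
                (n.factorial : ℂ))
        + (β : ℂ)⁻¹ * G (-1)
        + (∑ l ∈ Finset.range ((⌊θ⌋ + 1).toNat),
            ((-1 : ℂ) ^ l * riemannZeta (-(l : ℂ)) / (l.factorial : ℂ)) * (β : ℂ) ^ l *
              G (l : ℂ))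
        + (1 / (2 * (Real.pi : ℂ))) *
            ∫ t : ℝ, Complex.Gamma (-(θ : ℂ) - (t : ℂ) * Complex.I) *
              riemannZeta (-(θ : ℂ) - (t : ℂ) * Complex.I) *
              (β : ℂ) ^ ((θ : ℂ) + (t : ℂ) * Complex.I) *
              G ((θ : ℂ) + (t : ℂ) * Complex.I) := by
  have hδ : 0 < ωc - μ := by linarith
  set L : ℕ := (⌊θ⌋ + 1).toNat with hL
  have hfl : -1 ≤ ⌊θ⌋ := Int.le_floor.mpr (by push_cast; linarith)
  have hLZ : (L : ℤ) = ⌊θ⌋ + 1 := Int.toNat_of_nonneg (by omega)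
  have hLR : (L : ℝ) = ⌊θ⌋ + 1 := by exact_mod_cast hLZ
  have h2 : θ < L := by rw [hLR]; exact Int.lt_floor_add_one θ
  have h1 : (L:ℝ) - 1 < θ := by
    rw [hLR, add_sub_cancel_right]
    exact lt_of_le_of_ne (Int.floor_le θ) (hθZ _).symm
  have hloc' := shift_loc ωc μ g hloc
  have hO := hR_bigO α hα N μ hμ0 c g hasymp a ha
  have hG' : ∀ s : ℂ, G s =
      (∫ y in Set.Ici (ωc - μ), (y : ℂ) ^ s *
          (g (y + μ) - ∑ m ∈ Finset.range (N + 1), a m * (y : ℂ) ^ (α - (m : ℂ))))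
        - ∑ m ∈ Finset.range (N + 1),
            a m * ((ωc - μ : ℝ) : ℂ) ^ (s + α + 1 - (m : ℂ)) / (s + α + 1 - (m : ℂ)) := by
    intro s
    rw [hG s, ← shift_integral ωc μ]
    simp only [sub_add_cancel]
  obtain ⟨r1, r2⟩ := main_y α hα N L hδ hβ (fun y => g (y + μ)) a hloc' hO G hG' θ hθZ hθ1 hθ2 hθ3 h1 h2
  have r0 := g_bose_int α N hδ hβ (fun y => g (y + μ)) a hloc' hO
  rw [← shift_integrable] at r0
  rw [← shift_integral ωc μ (fun y => g (y + μ) * bose (β * y))] at r2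
  simp only [sub_add_cancel, bose, mul_one_div] at r0 r2
  refine ⟨r0, r1, ?_⟩
  rw [r2, Finset.sum_range_succ' _ L]
  simp only [Kf]
  have e1 : ∀ m ∈ Finset.range (N + 1), (β : ℂ) ^ ((m : ℂ) - α - 1) *
            riemannZeta (α + 1 - (m : ℂ)) * (a m * Complex.Gamma (α + 1 - m)) =
      (β : ℂ) ^ ((m : ℂ) - α - 1) *
            riemannZeta (α + 1 - (m : ℂ)) *
            ∑ n ∈ Finset.range (m + 1),
              Complex.Gamma (α + 1 - (m : ℂ) + (n : ℂ)) * c (m - n) * (μ : ℂ) ^ n /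
                (n.factorial : ℂ) := by
    intro m _
    congr 1
    have hne : Complex.Gamma (α + 1 - m) ≠ 0 := by
      apply Complex.Gamma_ne_zero
      intro k hk
      apply hα (m - 1 - k)
      push_cast
      linear_combination hk
    rw [ha, Finset.sum_mul]
    apply Finset.sum_congr rfl
    intro n _
    field_simp
  have e2 : ∀ l ∈ Finset.range L, bn (l + 1) * (β:ℂ) ^ (((l + 1 : ℕ):ℂ) - 1) * G (((l + 1 : ℕ):ℂ) - 1) =
      ((-1 : ℂ) ^ l * riemannZeta (-(l : ℂ)) / (l.factorial : ℂ)) * (β : ℂ) ^ l * G (l : ℂ) := by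
    intro l _
    rw [bn_succ']
    push_cast
    rw [add_sub_cancel_right, Complex.cpow_natCast]
  rw [Finset.sum_congr rfl e1, Finset.sum_congr rfl e2, bn_zero']
  simp only [Nat.cast_zero, zero_sub, Complex.cpow_neg_one, one_mul]
  ring
end
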